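/- arXiv:1810.01309 — 5 statements merged into one kernel-verified Lean document; each statement's English description precedes it below -/
import Mathlib

section
/- For any ψ ∈ C_c^∞(ℝ³ \ {0})⁴ one has ∫_{ℝ³} |ψ|²/|x| dx ≤ ∫_{ℝ³} |(1 + 2 S·L)ψ|²/|x| dx, with equality if and only if the partial wave components of ψ with k_j ≠ ±1 vanish. -/
open Matrix MeasureTheory

noncomputable section

/-- The Pauli matrices. -/
def Pauli : Fin 3 → Matrix (Fin 2) (Fin 2) ℂ :=
  ![!![0, 1; 1, 0], !![0, -Complex.I; Complex.I, 0], !![1, 0; 0, -1]]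

/-- The Dirac matrix `β = diag(I₂, -I₂)`. -/
def diracBeta : Matrix (Fin 2 ⊕ Fin 2) (Fin 2 ⊕ Fin 2) ℂ := Matrix.fromBlocks 1 0 0 (-1)

/-- The Dirac matrices `α_j = [[0, σ_j], [σ_j, 0]]`. -/
def diracAlpha (j : Fin 3) : Matrix (Fin 2 ⊕ Fin 2) (Fin 2 ⊕ Fin 2) ℂ :=
  Matrix.fromBlocks 0 (Pauli j) (Pauli j) 0

/-- The spin matrices `S_j = (1/2) diag(σ_j, σ_j)`. -/
def spinS (j : Fin 3) : Matrix (Fin 2 ⊕ Fin 2) (Fin 2 ⊕ Fin 2) ℂ :=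
  Matrix.fromBlocks ((1 / 2 : ℂ) • Pauli j) 0 0 ((1 / 2 : ℂ) • Pauli j)

/-- The `j`-th partial derivative of a 4-spinor field. -/
def pd (j : Fin 3) (ψ : EuclideanSpace ℝ (Fin 3) → (Fin 2 ⊕ Fin 2) → ℂ)
    (x : EuclideanSpace ℝ (Fin 3)) : (Fin 2 ⊕ Fin 2) → ℂ :=
  fderiv ℝ ψ x (EuclideanSpace.single j 1)

/-- The components of the orbital angular momentum `L = -i x ∧ ∇`
(acting componentwise): `L_j = -i (x_{j+1} ∂_{j+2} - x_{j+2} ∂_{j+1})` (cyclically). -/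
def angL (j : Fin 3) (ψ : EuclideanSpace ℝ (Fin 3) → (Fin 2 ⊕ Fin 2) → ℂ)
    (x : EuclideanSpace ℝ (Fin 3)) : (Fin 2 ⊕ Fin 2) → ℂ :=
  (-Complex.I) • (((x (j + 1) : ℝ) : ℂ) • pd (j + 2) ψ x
    - ((x (j + 2) : ℝ) : ℂ) • pd (j + 1) ψ x)

/-- The spin-orbit operator `(1 + 2 S·L)`. -/
def opK (ψ : EuclideanSpace ℝ (Fin 3) → (Fin 2 ⊕ Fin 2) → ℂ)
    (x : EuclideanSpace ℝ (Fin 3)) : (Fin 2 ⊕ Fin 2) → ℂ :=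
  ψ x + (2 : ℂ) • ∑ j, (spinS j).mulVec (angL j ψ x)

/-- The Dirac kinetic operator `-i α·∇`. -/
def diracKin (ψ : EuclideanSpace ℝ (Fin 3) → (Fin 2 ⊕ Fin 2) → ℂ)
    (x : EuclideanSpace ℝ (Fin 3)) : (Fin 2 ⊕ Fin 2) → ℂ :=
  (-Complex.I) • ∑ j, (diracAlpha j).mulVec (pd j ψ x)

section RotationFields

variable {F : Type*} [NormedAddCommGroup F] [NormedSpace ℝ F]

/-- The infinitesimal rotation `x ↦ e_j × x` of `ℝ³`. -/
def rotGen (j : Fin 3) : EuclideanSpace ℝ (Fin 3) →L[ℝ] EuclideanSpace ℝ (Fin 3) :=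
  (EuclideanSpace.proj (j + 1) : EuclideanSpace ℝ (Fin 3) →L[ℝ] ℝ).smulRight
      (EuclideanSpace.single (j + 2) 1)
    - (EuclideanSpace.proj (j + 2) : EuclideanSpace ℝ (Fin 3) →L[ℝ] ℝ).smulRight
      (EuclideanSpace.single (j + 1) 1)

lemma rotGen_apply (j : Fin 3) (x : EuclideanSpace ℝ (Fin 3)) :
    rotGen j x = x (j + 1) • EuclideanSpace.single (j + 2) (1 : ℝ)
      - x (j + 2) • EuclideanSpace.single (j + 1) (1 : ℝ) := rfl

lemma inner_rotGen_self (j : Fin 3) (x : EuclideanSpace ℝ (Fin 3)) :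
    inner ℝ x (rotGen j x) = 0 := by
  rw [rotGen_apply, inner_sub_right, inner_smul_right, inner_smul_right,
    EuclideanSpace.inner_single_right, EuclideanSpace.inner_single_right]
  simp
  ring

lemma sum_smul_rotGen (x : EuclideanSpace ℝ (Fin 3)) : ∑ j, x j • rotGen j x = 0 := by
  ext i
  fin_cases i <;> simp [Fin.sum_univ_three, rotGen_apply] <;> ring

lemma rotGen_comm (j : Fin 3) (x : EuclideanSpace ℝ (Fin 3)) :
    rotGen (j + 1) (rotGen j x) - rotGen j (rotGen (j + 1) x) = -rotGen (j + 2) x := by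
  ext i
  fin_cases j <;> fin_cases i <;> simp [rotGen_apply]

/-- The derivative of `f` along the infinitesimal rotation about the `j`-th axis. -/
def rotDeriv (j : Fin 3) (f : EuclideanSpace ℝ (Fin 3) → F) (x : EuclideanSpace ℝ (Fin 3)) : F :=
  fderiv ℝ f x (rotGen j x)

lemma sum_smul_rotDeriv (f : EuclideanSpace ℝ (Fin 3) → F) (x : EuclideanSpace ℝ (Fin 3)) :
    ∑ j, x j • rotDeriv j f x = 0 := by
  have h := congrArg (fderiv ℝ f x) (sum_smul_rotGen x)
  simpa only [map_sum, map_smul, map_zero, rotDeriv] using h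

lemma contDiff_rotDeriv (j : Fin 3) {f : EuclideanSpace ℝ (Fin 3) → F}
    (hf : ContDiff ℝ (⊤ : ℕ∞) f) : ContDiff ℝ (⊤ : ℕ∞) (rotDeriv j f) :=
  (hf.fderiv_right (by simp)).clm_apply (rotGen j).contDiff

lemma rotDeriv_rotDeriv (j k : Fin 3) {f : EuclideanSpace ℝ (Fin 3) → F}
    (hf : ContDiff ℝ (⊤ : ℕ∞) f) (x : EuclideanSpace ℝ (Fin 3)) :
    rotDeriv j (rotDeriv k f) x = fderiv ℝ (fderiv ℝ f) x (rotGen j x) (rotGen k x)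
      + fderiv ℝ f x (rotGen k (rotGen j x)) := by
  have h1 : HasFDerivAt (fderiv ℝ f) (fderiv ℝ (fderiv ℝ f) x) x :=
    ((hf.fderiv_right (m := (⊤ : ℕ∞)) (by simp)).differentiable (by simp) x).hasFDerivAt
  have h2 := h1.clm_apply (rotGen k).hasFDerivAt (x := x)
  have h3 : fderiv ℝ (rotDeriv k f) x = _ := h2.fderiv
  rw [rotDeriv, h3]
  simp [add_comm]

lemma rotDeriv_comm (j : Fin 3) {f : EuclideanSpace ℝ (Fin 3) → F}
    (hf : ContDiff ℝ (⊤ : ℕ∞) f) (x : EuclideanSpace ℝ (Fin 3)) :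
    rotDeriv j (rotDeriv (j + 1) f) x
      = rotDeriv (j + 1) (rotDeriv j f) x - rotDeriv (j + 2) f x := by
  have hsymm : IsSymmSndFDerivAt ℝ f x :=
    hf.contDiffAt.isSymmSndFDerivAt (by
      rw [minSmoothness_of_isRCLikeNormedField]
      exact WithTop.coe_le_coe.2 (le_top (a := (2 : ℕ∞))))
  rw [rotDeriv_rotDeriv _ _ hf, rotDeriv_rotDeriv _ _ hf, hsymm.eq, add_sub_assoc, rotDeriv,
    ← map_sub, ← sub_eq_iff_eq_add'.2 (sub_eq_iff_eq_add.1 (rotGen_comm j x))]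
  simp

lemma rotDeriv_clm_comp (T : F →L[ℝ] F) (j : Fin 3) {f : EuclideanSpace ℝ (Fin 3) → F}
    (hf : ContDiff ℝ (⊤ : ℕ∞) f) (x : EuclideanSpace ℝ (Fin 3)) :
    rotDeriv j (fun y => T (f y)) x = T (rotDeriv j f x) := by
  have h := (T.hasFDerivAt.comp x (hf.differentiable (by simp) x).hasFDerivAt).fderiv
  simp only [rotDeriv]
  rw [show (fun y => T (f y)) = T ∘ f from rfl, h]
  rfl

/-- Smooth functions vanishing outside the set `C`. -/
structure SmoothOnlyOn (C : Set (EuclideanSpace ℝ (Fin 3)))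
    (f : EuclideanSpace ℝ (Fin 3) → F) : Prop where
  contDiff : ContDiff ℝ (⊤ : ℕ∞) f
  eq_zero : ∀ x ∉ C, f x = 0

namespace SmoothOnlyOn

variable {C : Set (EuclideanSpace ℝ (Fin 3))} {f g : EuclideanSpace ℝ (Fin 3) → F}

lemma add (hf : SmoothOnlyOn C f) (hg : SmoothOnlyOn C g) :
    SmoothOnlyOn C (fun x => f x + g x) :=
  ⟨hf.contDiff.add hg.contDiff, fun x hx => by simp [hf.eq_zero x hx, hg.eq_zero x hx]⟩

lemma sub (hf : SmoothOnlyOn C f) (hg : SmoothOnlyOn C g) :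
    SmoothOnlyOn C (fun x => f x - g x) :=
  ⟨hf.contDiff.sub hg.contDiff, fun x hx => by simp [hf.eq_zero x hx, hg.eq_zero x hx]⟩

lemma clm_comp (T : F →L[ℝ] F) (hf : SmoothOnlyOn C f) : SmoothOnlyOn C (fun x => T (f x)) :=
  ⟨T.contDiff.comp hf.contDiff, fun x hx => by simp [hf.eq_zero x hx]⟩

lemma sum {ι : Type*} {s : Finset ι} {f : ι → EuclideanSpace ℝ (Fin 3) → F}
    (hf : ∀ i ∈ s, SmoothOnlyOn C (f i)) : SmoothOnlyOn C (fun x => ∑ i ∈ s, f i x) :=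
  ⟨ContDiff.sum fun i hi => (hf i hi).contDiff,
    fun x hx => Finset.sum_eq_zero fun i hi => (hf i hi).eq_zero x hx⟩

lemma eventuallyEq_zero (hC : IsClosed C) (hf : SmoothOnlyOn C f)
    {x : EuclideanSpace ℝ (Fin 3)} (hx : x ∉ C) : f =ᶠ[nhds x] 0 := by
  filter_upwards [hC.isOpen_compl.mem_nhds hx] with y hy using hf.eq_zero y hy

lemma rotDeriv (hC : IsClosed C) (hf : SmoothOnlyOn C f) (j : Fin 3) :
    SmoothOnlyOn C (rotDeriv j f) :=
  ⟨contDiff_rotDeriv j hf.contDiff, fun x hx => by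
    rw [_root_.rotDeriv, (hf.eventuallyEq_zero hC hx).fderiv_eq]
    simp⟩

lemma integrable (hC : IsCompact C) (hf : SmoothOnlyOn C f) : Integrable f :=
  hf.contDiff.continuous.integrable_of_hasCompactSupport
    (HasCompactSupport.intro hC hf.eq_zero)

lemma div_norm (hC : IsClosed C) (h0 : 0 ∉ C) {h : EuclideanSpace ℝ (Fin 3) → ℝ}
    (hh : SmoothOnlyOn C h) : SmoothOnlyOn C (fun x => h x / ‖x‖) := by
  refine ⟨contDiff_iff_contDiffAt.2 fun x => ?_, fun x hx => by simp [hh.eq_zero x hx]⟩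
  by_cases hx : x ∈ C
  · have hx0 : x ≠ 0 := fun h => h0 (h ▸ hx)
    exact hh.contDiff.contDiffAt.div (contDiffAt_norm ℝ hx0) (norm_ne_zero_iff.2 hx0)
  · refine contDiffAt_const (c := (0 : ℝ)) |>.congr_of_eventuallyEq ?_
    filter_upwards [hh.eventuallyEq_zero hC hx] with y hy
    simp [hy]

lemma integral_rotDeriv (hC : IsCompact C) {h : EuclideanSpace ℝ (Fin 3) → ℝ}
    (hh : SmoothOnlyOn C h) (j : Fin 3) : ∫ x, _root_.rotDeriv j h x = 0 := by
  have hz : ∀ x ∉ C, ∀ v, fderiv ℝ h x v = 0 := fun x hx v => by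
    rw [(hh.eventuallyEq_zero hC.isClosed hx).fderiv_eq]; simp
  have hd : Continuous (fderiv ℝ h) := hh.contDiff.continuous_fderiv (by simp)
  have hint : ∀ a b : Fin 3, Integrable
      (fun x : EuclideanSpace ℝ (Fin 3) => x a * fderiv ℝ h x (EuclideanSpace.single b 1)) :=
    fun a b => Continuous.integrable_of_hasCompactSupport (by fun_prop)
      (HasCompactSupport.intro hC fun x hx => by simp [hz x hx])
  have hparts : ∀ a b : Fin 3, a ≠ b →
      ∫ x : EuclideanSpace ℝ (Fin 3), x a * fderiv ℝ h x (EuclideanSpace.single b 1) = 0 := by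
    intro a b hab
    have hp : ∀ x : EuclideanSpace ℝ (Fin 3), fderiv ℝ (fun y : EuclideanSpace ℝ (Fin 3) => y a) x
        (EuclideanSpace.single b 1) = 0 := fun x => by
      have := (EuclideanSpace.proj a : EuclideanSpace ℝ (Fin 3) →L[ℝ] ℝ).hasFDerivAt (x := x)
      have h3 : fderiv ℝ (fun y : EuclideanSpace ℝ (Fin 3) => y a) x = _ := this.fderiv
      rw [h3]
      simp [hab]
    rw [integral_mul_fderiv_eq_neg_fderiv_mul_of_integrable]
    · simp [hp]
    · simp [hp]
    · exact hint a b
    · exact Continuous.integrable_of_hasCompactSupport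
        (by have := hh.contDiff.continuous; fun_prop)
        (HasCompactSupport.intro hC fun x hx => by simp [hh.eq_zero x hx])
    · fun_prop
    · exact fun x _ => hh.contDiff.differentiable (by simp) x
  simp only [_root_.rotDeriv, rotGen_apply, map_sub, map_smul, smul_eq_mul]
  rw [integral_sub (hint _ _) (hint _ _), hparts _ _ (by simp), hparts _ _ (by simp), sub_zero]

lemma rotDeriv_div_norm (hC : IsClosed C) (h0 : 0 ∉ C) {h : EuclideanSpace ℝ (Fin 3) → ℝ}
    (hh : SmoothOnlyOn C h) (j : Fin 3) (x : EuclideanSpace ℝ (Fin 3)) :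
    _root_.rotDeriv j (fun y => h y / ‖y‖) x = _root_.rotDeriv j h x / ‖x‖ := by
  by_cases hx : x ∈ C
  · have hx0 : x ≠ 0 := fun h => h0 (h ▸ hx)
    have hr : HasFDerivAt (fun y : EuclideanSpace ℝ (Fin 3) => ‖y‖) _ x :=
      (differentiableAt_id.norm ℝ hx0).hasFDerivAt
    have hq := ((hh.div_norm hC h0).contDiff.differentiable (by simp) x).hasFDerivAt
    have hr0 : fderiv ℝ (fun y : EuclideanSpace ℝ (Fin 3) => ‖y‖) x (rotGen j x) = 0 := by
      have h1 := hr.pow 2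
      have h2 := (hasStrictFDerivAt_norm_sq x).hasFDerivAt
      have h3 := DFunLike.congr_fun (h1.unique h2) (rotGen j x)
      simpa [inner_rotGen_self, hx0] using h3
    have heq : h =ᶠ[nhds x] fun y => h y / ‖y‖ * ‖y‖ := by
      filter_upwards [isOpen_ne.mem_nhds hx0] with y hy
      exact (div_mul_cancel₀ _ (norm_ne_zero_iff.2 hy)).symm
    rw [eq_div_iff (norm_ne_zero_iff.2 hx0)]
    unfold _root_.rotDeriv
    rw [heq.fderiv_eq, (hq.fun_mul hr).fderiv]
    simp only [_root_.add_apply, _root_.smul_apply, smul_eq_mul, id]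
    rw [hr0]
    ring
  · rw [((hh.div_norm hC h0).rotDeriv hC j).eq_zero x hx, (hh.rotDeriv hC j).eq_zero x hx, zero_div]

end SmoothOnlyOn

lemma rotDeriv_sum {ι : Type*} {s : Finset ι} {f : ι → EuclideanSpace ℝ (Fin 3) → F}
    (hf : ∀ i ∈ s, ContDiff ℝ (⊤ : ℕ∞) (f i)) (j : Fin 3) (x : EuclideanSpace ℝ (Fin 3)) :
    rotDeriv j (fun y => ∑ i ∈ s, f i y) x = ∑ i ∈ s, rotDeriv j (f i) x := by
  simp only [rotDeriv]
  rw [fderiv_fun_sum fun i hi => (hf i hi).differentiable (by simp) x]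
  simp

end RotationFields

section SpinOrbit

variable {F : Type*} [NormedAddCommGroup F] [InnerProductSpace ℝ F]
  {C : Set (EuclideanSpace ℝ (Fin 3))} {f g h : EuclideanSpace ℝ (Fin 3) → F}

/-- The inner product on `F`-valued functions on `ℝ³` with weight `1 / |x|`. -/
def wInner (f g : EuclideanSpace ℝ (Fin 3) → F) : ℝ := ∫ x, inner ℝ (f x) (g x) / ‖x‖

lemma wInner_comm (f g : EuclideanSpace ℝ (Fin 3) → F) : wInner f g = wInner g f := by
  simp only [wInner, real_inner_comm]

lemma SmoothOnlyOn.inner (hf : SmoothOnlyOn C f) (hg : SmoothOnlyOn C g) :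
    SmoothOnlyOn C (fun x => inner ℝ (f x) (g x)) :=
  ⟨hf.contDiff.inner ℝ hg.contDiff, fun x hx => by simp [hf.eq_zero x hx]⟩

lemma integrable_wInner (hC : IsCompact C) (h0 : 0 ∉ C) (hf : SmoothOnlyOn C f)
    (hg : SmoothOnlyOn C g) : Integrable (fun x => inner ℝ (f x) (g x) / ‖x‖) :=
  ((hf.inner hg).div_norm hC.isClosed h0).integrable hC

lemma wInner_add_left (hC : IsCompact C) (h0 : 0 ∉ C) (hf : SmoothOnlyOn C f)
    (hg : SmoothOnlyOn C g) (hh : SmoothOnlyOn C h) :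
    wInner (fun x => f x + g x) h = wInner f h + wInner g h := by
  simp only [wInner, inner_add_left, add_div]
  exact integral_add (integrable_wInner hC h0 hf hh) (integrable_wInner hC h0 hg hh)

lemma wInner_sub_left (hC : IsCompact C) (h0 : 0 ∉ C) (hf : SmoothOnlyOn C f)
    (hg : SmoothOnlyOn C g) (hh : SmoothOnlyOn C h) :
    wInner (fun x => f x - g x) h = wInner f h - wInner g h := by
  simp only [wInner, inner_sub_left, sub_div]
  exact integral_sub (integrable_wInner hC h0 hf hh) (integrable_wInner hC h0 hg hh)

lemma wInner_smul_left (c : ℝ) (f g : EuclideanSpace ℝ (Fin 3) → F) :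
    wInner (fun x => c • f x) g = c * wInner f g := by
  simp only [wInner, real_inner_smul_left, mul_div_assoc]
  exact integral_const_mul _ _

lemma wInner_sum_left (hC : IsCompact C) (h0 : 0 ∉ C) {ι : Type*} {s : Finset ι}
    {f : ι → EuclideanSpace ℝ (Fin 3) → F} (hf : ∀ i ∈ s, SmoothOnlyOn C (f i))
    (hg : SmoothOnlyOn C g) :
    wInner (fun x => ∑ i ∈ s, f i x) g = ∑ i ∈ s, wInner (f i) g := by
  simp only [wInner, sum_inner, Finset.sum_div]
  exact integral_finsetSum _ fun i hi => integrable_wInner hC h0 (hf i hi) hg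

lemma eq_zero_of_wInner_self (hC : IsCompact C) (h0 : 0 ∉ C) (hf : SmoothOnlyOn C f)
    (h : wInner f f = 0) (x : EuclideanSpace ℝ (Fin 3)) : f x = 0 := by
  have hs := (hf.inner hf).div_norm hC.isClosed h0
  have hz := (hs.contDiff.continuous.ae_eq_iff_eq volume continuous_zero).1
    ((integral_eq_zero_iff_of_nonneg
      (fun x => div_nonneg real_inner_self_nonneg (norm_nonneg x)) (hs.integrable hC)).1 h)
  by_cases hx : x ∈ C
  · have hx0 : x ≠ 0 := fun h => h0 (h ▸ hx)
    simpa [hx0] using congrFun hz x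
  · exact hf.eq_zero x hx

lemma wInner_rotDeriv_left (hC : IsCompact C) (h0 : 0 ∉ C) (hf : SmoothOnlyOn C f)
    (hg : SmoothOnlyOn C g) (j : Fin 3) :
    wInner (rotDeriv j f) g = -wInner f (rotDeriv j g) := by
  have hprod : ∀ x, rotDeriv j (fun y => inner ℝ (f y) (g y)) x
      = inner ℝ (rotDeriv j f x) (g x) + inner ℝ (f x) (rotDeriv j g x) := fun x => by
    rw [rotDeriv, fderiv_inner_apply ℝ (hf.contDiff.differentiable (by simp) x)
      (hg.contDiff.differentiable (by simp) x), add_comm]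
    rfl
  have hfg := hf.inner hg
  have hint := (hfg.div_norm hC.isClosed h0).integral_rotDeriv hC j
  simp only [hfg.rotDeriv_div_norm hC.isClosed h0, hprod, add_div] at hint
  rw [integral_add (integrable_wInner hC h0 (hf.rotDeriv hC.isClosed j) hg)
    (integrable_wInner hC h0 hf (hg.rotDeriv hC.isClosed j))] at hint
  exact eq_neg_of_add_eq_zero_left hint

/-- Three skew-symmetric operators satisfying the relations of the quaternion units. -/
structure IsQuaternionic (T : Fin 3 → F →L[ℝ] F) : Prop where
  skew : ∀ j u v, inner ℝ (T j u) v = -inner ℝ u (T j v)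
  sq : ∀ j u, T j (T j u) = -u
  mul_succ : ∀ j u, T j (T (j + 1) u) = T (j + 2) u
  succ_mul : ∀ j u, T (j + 1) (T j u) = -T (j + 2) u

/-- The operator `∑ j, T j R_j`, where `R_j` is the derivative along the `j`-th rotation. For
`T j = -i σ_j` this is `σ · L`. -/
def spinOrbit (T : Fin 3 → F →L[ℝ] F) (f : EuclideanSpace ℝ (Fin 3) → F)
    (x : EuclideanSpace ℝ (Fin 3)) : F :=
  ∑ j, T j (rotDeriv j f x)

variable {T : Fin 3 → F →L[ℝ] F}

lemma SmoothOnlyOn.spinOrbit (hC : IsClosed C) (hf : SmoothOnlyOn C f) :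
    SmoothOnlyOn C (spinOrbit T f) :=
  SmoothOnlyOn.sum fun j _ => (hf.rotDeriv hC j).clm_comp (T j)

lemma wInner_spinOrbit_left (hT : IsQuaternionic T) (hC : IsCompact C) (h0 : 0 ∉ C)
    (hf : SmoothOnlyOn C f) (hg : SmoothOnlyOn C g) :
    wInner (spinOrbit T f) g = wInner f (spinOrbit T g) := by
  have hr := fun (j : Fin 3) {f : EuclideanSpace ℝ (Fin 3) → F} (hf : SmoothOnlyOn C f) =>
    (hf.rotDeriv hC.isClosed j).clm_comp (T j)
  rw [wInner_comm f]
  unfold spinOrbit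
  rw [wInner_sum_left hC h0 (fun j _ => hr j hf) hg, wInner_sum_left hC h0 (fun j _ => hr j hg) hf]
  refine Finset.sum_congr rfl fun j _ => ?_
  calc wInner (fun x => T j (rotDeriv j f x)) g
      = -wInner (rotDeriv j f) (fun x => T j (g x)) := by
        simp only [wInner, hT.skew, neg_div, integral_neg]
    _ = wInner f (rotDeriv j fun x => T j (g x)) := by
        rw [wInner_rotDeriv_left hC h0 hf (hg.clm_comp (T j)), neg_neg]
    _ = wInner (fun x => T j (rotDeriv j g x)) f := by
        rw [wInner_comm]
        simp only [wInner, rotDeriv_clm_comp _ _ hg.contDiff]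

lemma spinOrbit_spinOrbit (hT : IsQuaternionic T) (hf : ContDiff ℝ (⊤ : ℕ∞) f)
    (x : EuclideanSpace ℝ (Fin 3)) :
    spinOrbit T (spinOrbit T f) x
      = -(∑ j, rotDeriv j (rotDeriv j f) x) - spinOrbit T f x := by
  have hexp : ∀ j, rotDeriv j (spinOrbit T f) x = ∑ k, T k (rotDeriv j (rotDeriv k f) x) := by
    intro j
    have hr := fun k => contDiff_rotDeriv k hf
    rw [show spinOrbit T f = fun y => ∑ k, T k (rotDeriv k f y) from rfl,
      rotDeriv_sum (f := fun k y => T k (rotDeriv k f y)) fun k _ => (T k).contDiff.comp (hr k)]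
    exact Finset.sum_congr rfl fun k _ => rotDeriv_clm_comp (T k) j (hr k) x
  have c0 := rotDeriv_comm 0 hf x
  have c1 := rotDeriv_comm 1 hf x
  have c2 := rotDeriv_comm 2 hf x
  have p0 := hT.mul_succ 0
  have p1 := hT.mul_succ 1
  have p2 := hT.mul_succ 2
  have q0 := hT.succ_mul 0
  have q1 := hT.succ_mul 1
  have q2 := hT.succ_mul 2
  simp only [zero_add, Fin.isValue, show (1 : Fin 3) + 1 = 2 from rfl,
    show (1 : Fin 3) + 2 = 0 from rfl, show (2 : Fin 3) + 1 = 0 from rfl,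
    show (2 : Fin 3) + 2 = 1 from rfl] at c0 c1 c2 p0 p1 p2 q0 q1 q2
  rw [spinOrbit]
  simp only [hexp, spinOrbit, Fin.sum_univ_three, map_add, hT.sq, p0, p1, p2, q0, q1, q2, c0, c1,
    c2, map_sub]
  abel

lemma wInner_spinOrbit_self (hT : IsQuaternionic T) (hC : IsCompact C) (h0 : 0 ∉ C)
    (hf : SmoothOnlyOn C f) :
    wInner (spinOrbit T f) (spinOrbit T f)
      = ∑ j, wInner (rotDeriv j f) (rotDeriv j f) - wInner (spinOrbit T f) f := by
  have hr := fun j => (hf.rotDeriv hC.isClosed j).rotDeriv hC.isClosed j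
  have hA := hf.spinOrbit hC.isClosed (T := T)
  rw [← wInner_spinOrbit_left hT hC h0 hA hf,
    show spinOrbit T (spinOrbit T f) = _ from funext (spinOrbit_spinOrbit hT hf.contDiff),
    ← sub_eq_zero]
  simp only [← neg_one_smul ℝ (∑ j, _)]
  rw [wInner_sub_left hC h0 _ hA hf, wInner_smul_left,
    wInner_sum_left hC h0 (fun j _ => hr j) hf]
  · simp only [fun j => wInner_rotDeriv_left hC h0 (hf.rotDeriv hC.isClosed j) hf j]
    simp
  · simpa using (SmoothOnlyOn.sum fun j _ => hr j).clm_comp (-1 : F →L[ℝ] F)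

/-- Since `x · r = 0`, the Cauchy–Schwarz constant `3` improves to `2`. -/
lemma norm_sum_quaternionic_sq_le (hT : IsQuaternionic T) {x : EuclideanSpace ℝ (Fin 3)}
    (hx : x ≠ 0) {r : Fin 3 → F} (hr : ∑ j, x j • r j = 0) :
    ‖∑ j, T j (r j)‖ ^ 2 ≤ 2 * ∑ j, ‖r j‖ ^ 2 := by
  set a := ∑ j, T j (r j) with ha
  set n : ℝ := ∑ j, x j ^ 2 with hn
  have hn0 : 0 < n := by
    rw [hn, ← EuclideanSpace.real_norm_sq_eq]; positivity
  set b := ∑ j, x j • T j a with hb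
  have hself : ∀ j, inner ℝ (T j a) (T j a) = inner ℝ a a := fun j => by
    rw [hT.skew, hT.sq, inner_neg_right, neg_neg]
  have horth : ∀ j, inner ℝ (T j a) (T (j + 1) a) = 0 := fun j => by
    have h1 := hT.skew (j + 2) a a
    rw [real_inner_comm] at h1
    rw [hT.skew, hT.mul_succ]; linarith
  have o0 : inner ℝ (T 0 a) (T 1 a) = 0 := horth 0
  have o1 : inner ℝ (T 1 a) (T 2 a) = 0 := horth 1
  have o2 : inner ℝ (T 2 a) (T 0 a) = 0 := horth 2
  have o0' : inner ℝ (T 1 a) (T 0 a) = 0 := by rw [real_inner_comm, o0]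
  have o1' : inner ℝ (T 2 a) (T 1 a) = 0 := by rw [real_inner_comm, o1]
  have o2' : inner ℝ (T 0 a) (T 2 a) = 0 := by rw [real_inner_comm, o2]
  have hTb : ∀ j, inner ℝ (T j a) b = x j * inner ℝ a a := fun j => by
    fin_cases j <;>
      simp only [hb, Fin.sum_univ_three, inner_add_right, real_inner_smul_right, Fin.isValue,
        Fin.zero_eta, Fin.mk_one, Fin.reduceFinMk, o0, o1, o2, o0', o1', o2', hself] <;> ring
  have hbb : inner ℝ b b = n * inner ℝ a a := by
    nth_rewrite 1 [hb]
    simp only [sum_inner, real_inner_smul_left, hTb, hn, Finset.sum_mul]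
    exact Finset.sum_congr rfl fun j _ => by ring
  have hbr : ∑ j, x j * inner ℝ b (r j) = 0 := by
    simp only [← real_inner_smul_right, ← inner_sum, hr, inner_zero_right]
  have hTr : ∑ j, inner ℝ (T j a) (r j) = -inner ℝ a a := by
    simp only [hT.skew, Finset.sum_neg_distrib, ← inner_sum, ← ha]
  have hkey : 0 ≤ ∑ j, ‖(2 * n) • r j + (n • T j a - x j • b)‖ ^ 2 := by positivity
  have hexp : ∀ j, ‖(2 * n) • r j + (n • T j a - x j • b)‖ ^ 2
      = 4 * n ^ 2 * ‖r j‖ ^ 2 + 4 * n ^ 2 * inner ℝ (T j a) (r j)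
        - 4 * n * (x j * inner ℝ b (r j)) + n ^ 2 * inner ℝ a a - n * x j ^ 2 * inner ℝ a a := by
    intro j
    rw [← real_inner_self_eq_norm_sq, ← real_inner_self_eq_norm_sq]
    simp only [inner_add_left, inner_add_right, inner_sub_left, inner_sub_right,
      real_inner_smul_left, real_inner_smul_right, hself, hTb, hbb, real_inner_comm (T j a) (r j),
      real_inner_comm b (r j), real_inner_comm (T j a) b]
    ring
  simp only [hexp, Finset.sum_add_distrib, Finset.sum_sub_distrib, ← Finset.mul_sum,
    ← Finset.sum_mul, hbr, hTr, ← hn] at hkey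
  simp only [Finset.sum_const, Finset.card_univ, Fintype.card_fin, nsmul_eq_mul] at hkey
  rw [← real_inner_self_eq_norm_sq]
  have : 0 ≤ 2 * n ^ 2 * (2 * ∑ j, ‖r j‖ ^ 2 - inner ℝ a a) := by
    push_cast at hkey; linarith
  have := nonneg_of_mul_nonneg_right this (by positivity)
  linarith

lemma wInner_spinOrbit_self_le (hT : IsQuaternionic T) (hC : IsCompact C) (h0 : 0 ∉ C)
    (hf : SmoothOnlyOn C f) :
    wInner (spinOrbit T f) (spinOrbit T f)
      ≤ 2 * ∑ j, wInner (rotDeriv j f) (rotDeriv j f) := by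
  have hr := fun j => hf.rotDeriv hC.isClosed j
  have hA := hf.spinOrbit hC.isClosed (T := T)
  have hi := fun j => integrable_wInner hC h0 (hr j) (hr j)
  simp only [wInner]
  rw [← integral_finsetSum _ fun j _ => hi j, ← integral_const_mul]
  refine integral_mono (integrable_wInner hC h0 hA hA)
    ((integrable_finsetSum _ fun j _ => hi j).const_mul _) fun x => ?_
  rcases eq_or_ne x 0 with rfl | hx
  · simp
  · have h := norm_sum_quaternionic_sq_le hT hx (sum_smul_rotDeriv f x)
    simp only [real_inner_self_eq_norm_sq, ← Finset.sum_div, ← mul_div_assoc]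
    exact div_le_div_of_nonneg_right h (norm_nonneg x)

/-- The operator `1 + ∑ j, T j R_j`. -/
def spinOrbitK (T : Fin 3 → F →L[ℝ] F) (f : EuclideanSpace ℝ (Fin 3) → F)
    (x : EuclideanSpace ℝ (Fin 3)) : F :=
  f x + spinOrbit T f x

lemma SmoothOnlyOn.spinOrbitK (hC : IsClosed C) (hf : SmoothOnlyOn C f) :
    SmoothOnlyOn C (spinOrbitK T f) :=
  hf.add (hf.spinOrbit hC)

lemma wInner_spinOrbitK_left (hT : IsQuaternionic T) (hC : IsCompact C) (h0 : 0 ∉ C)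
    (hf : SmoothOnlyOn C f) (hg : SmoothOnlyOn C g) :
    wInner (spinOrbitK T f) g = wInner f (spinOrbitK T g) := by
  rw [wInner_comm f]
  unfold spinOrbitK
  rw [wInner_add_left hC h0 hf (hf.spinOrbit hC.isClosed) hg,
    wInner_add_left hC h0 hg (hg.spinOrbit hC.isClosed) hf, wInner_comm g f,
    wInner_spinOrbit_left hT hC h0 hf hg, wInner_comm f, wInner_comm f]

theorem wInner_self_le_spinOrbitK (hT : IsQuaternionic T) (hC : IsCompact C) (h0 : 0 ∉ C)
    (hf : SmoothOnlyOn C f) :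
    wInner f f ≤ wInner (spinOrbitK T f) (spinOrbitK T f) := by
  have hA := hf.spinOrbit hC.isClosed (T := T)
  have hK : SmoothOnlyOn C (spinOrbitK T f) := hf.spinOrbitK hC.isClosed
  have h1 : ∀ {g}, SmoothOnlyOn C g →
      wInner (spinOrbitK T f) g = wInner f g + wInner (spinOrbit T f) g :=
    fun hg => wInner_add_left hC h0 hf hA hg
  rw [h1 hK, wInner_comm f (spinOrbitK T f), wInner_comm (spinOrbit T f) (spinOrbitK T f),
    h1 hf, h1 hA, wInner_comm f (spinOrbit T f)]
  have h2 := wInner_spinOrbit_self hT hC h0 hf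
  have h3 := wInner_spinOrbit_self_le hT hC h0 hf
  linarith

/-- Equality holds exactly on the eigenspace of the square with eigenvalue `1`: a nonnegative
quadratic form vanishes only on its kernel. -/
theorem wInner_self_eq_spinOrbitK_iff (hT : IsQuaternionic T) (hC : IsCompact C) (h0 : 0 ∉ C)
    (hf : SmoothOnlyOn C f) :
    wInner f f = wInner (spinOrbitK T f) (spinOrbitK T f)
      ↔ ∀ x, spinOrbitK T (spinOrbitK T f) x = f x := by
  have hK : SmoothOnlyOn C (spinOrbitK T f) := hf.spinOrbitK hC.isClosed
  have hKK : SmoothOnlyOn C (spinOrbitK T (spinOrbitK T f)) := hK.spinOrbitK hC.isClosed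
  constructor
  · intro heq x
    set g := fun x => spinOrbitK T (spinOrbitK T f) x - f x with hg_def
    have hg : SmoothOnlyOn C g := hKK.sub hf
    have hKg : SmoothOnlyOn C (spinOrbitK T g) := hg.spinOrbitK hC.isClosed
    have hgg : wInner g g = wInner (spinOrbitK T f) (spinOrbitK T g) - wInner f g := by
      rw [← wInner_spinOrbitK_left hT hC h0 hK hg]
      exact wInner_sub_left hC h0 hKK hf hg
    have hq : ∀ t : ℝ, 0 ≤ (wInner (spinOrbitK T g) (spinOrbitK T g) - wInner g g) * (t * t)
        + 2 * wInner g g * t + 0 := by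
      intro t
      have htg : SmoothOnlyOn C (fun x => t • g x) := by
        simpa using hg.clm_comp (t • (1 : F →L[ℝ] F))
      have hexpand : ∀ {u v : EuclideanSpace ℝ (Fin 3) → F}, SmoothOnlyOn C u → SmoothOnlyOn C v →
          wInner (fun x => u x + t • v x) (fun x => u x + t • v x)
            = wInner u u + 2 * t * wInner u v + t * t * wInner v v := by
        intro u v hu hv
        have htv : SmoothOnlyOn C (fun x => t • v x) := by
          simpa using hv.clm_comp (t • (1 : F →L[ℝ] F))
        have huv := hu.add htv
        rw [wInner_add_left hC h0 hu htv huv, wInner_smul_left, wInner_comm u, wInner_comm v,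
          wInner_add_left hC h0 hu htv hu, wInner_add_left hC h0 hu htv hv, wInner_smul_left,
          wInner_smul_left, wInner_comm v u]
        ring
      have hlin : spinOrbitK T (fun x => f x + t • g x)
          = fun x => spinOrbitK T f x + t • spinOrbitK T g x := by
        have hd : ∀ j x, rotDeriv j (fun x => f x + t • g x) x
            = rotDeriv j f x + t • rotDeriv j g x := fun j x => by
          have hfx := hf.contDiff.differentiable (by simp) x
          have hgx := hg.contDiff.differentiable (by simp) x
          simp only [rotDeriv]
          rw [(hfx.hasFDerivAt.fun_add (hgx.hasFDerivAt.fun_const_smul t)).fderiv]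
          rfl
        funext x
        simp only [spinOrbitK, spinOrbit, hd, map_add, map_smul, Finset.sum_add_distrib,
          ← Finset.smul_sum, smul_add]
        abel
      have hle := wInner_self_le_spinOrbitK hT hC h0 (hf.add htg)
      rw [hlin, hexpand hf hg, hexpand hK hKg] at hle
      linear_combination hle - heq - 2 * t * hgg
    have hdisc := discrim_le_zero hq
    simp only [discrim, mul_zero, sub_zero] at hdisc
    have hzero : wInner g g = 0 := by nlinarith [sq_nonneg (wInner g g)]
    exact sub_eq_zero.1 (eq_zero_of_wInner_self hC h0 hg hzero x)
  · intro h
    rw [← wInner_spinOrbitK_left hT hC h0 hK hf,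
      show spinOrbitK T (spinOrbitK T f) = f from funext h]

end SpinOrbit

section DiracSpinors

/-- The real linear operators `-i (2 S_j)` on `ℂ⁴` with its Euclidean inner product. -/
def spinUnit (j : Fin 3) :
    PiLp 2 (fun _ : Fin 2 ⊕ Fin 2 => ℂ) →L[ℝ] PiLp 2 (fun _ : Fin 2 ⊕ Fin 2 => ℂ) :=
  ((WithLp.linearEquiv 2 ℝ (Fin 2 ⊕ Fin 2 → ℂ)).symm.toLinearMap
    ∘ₗ ((-Complex.I * 2) • spinS j).mulVecLin.restrictScalars ℝ
    ∘ₗ (WithLp.linearEquiv 2 ℝ (Fin 2 ⊕ Fin 2 → ℂ)).toLinearMap).toContinuousLinearMap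

lemma spinUnit_apply (j : Fin 3) (u : PiLp 2 (fun _ : Fin 2 ⊕ Fin 2 => ℂ)) :
    spinUnit j u = WithLp.toLp 2 (((-Complex.I * 2) • spinS j).mulVec u.ofLp) := rfl

lemma Pauli_mul_self (j : Fin 3) : Pauli j * Pauli j = 1 := by
  fin_cases j <;> simp [Pauli, Matrix.one_fin_two]

lemma Pauli_mul_succ (j : Fin 3) : Pauli j * Pauli (j + 1) = Complex.I • Pauli (j + 2) := by
  fin_cases j <;> simp [Pauli]

lemma Pauli_succ_mul (j : Fin 3) : Pauli (j + 1) * Pauli j = -(Complex.I • Pauli (j + 2)) := by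
  fin_cases j <;> simp [Pauli]

lemma smul_spinS (j : Fin 3) : (-Complex.I * 2) • spinS j
    = Matrix.fromBlocks (-(Complex.I • Pauli j)) 0 0 (-(Complex.I • Pauli j)) := by
  simp [spinS, Matrix.fromBlocks_smul, smul_smul, Matrix.fromBlocks_neg]

lemma spinS_mul_spinS (j k : Fin 3) :
    ((-Complex.I * 2) • spinS j) * ((-Complex.I * 2) • spinS k)
      = Matrix.fromBlocks (-(Pauli j * Pauli k)) 0 0 (-(Pauli j * Pauli k)) := by
  rw [smul_spinS, smul_spinS, Matrix.fromBlocks_multiply]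
  simp [smul_smul]

lemma isQuaternionic_spinUnit : IsQuaternionic spinUnit where
  skew j u v := by
    fin_cases j <;>
      simp [spinUnit_apply, PiLp.inner_apply, spinS, Pauli, Matrix.mulVec, dotProduct,
        Complex.inner] <;> ring
  sq j u := by
    simp only [spinUnit_apply, Matrix.mulVec_mulVec, spinS_mul_spinS, Pauli_mul_self]
    rw [show (0 : Matrix (Fin 2) (Fin 2) ℂ) = -0 by simp, ← Matrix.fromBlocks_neg,
      Matrix.fromBlocks_one, Matrix.neg_mulVec, Matrix.one_mulVec]
    rfl
  mul_succ j u := by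
    simp only [spinUnit_apply, Matrix.mulVec_mulVec, spinS_mul_spinS, Pauli_mul_succ]
    rw [smul_spinS]
  succ_mul j u := by
    simp only [spinUnit_apply, Matrix.mulVec_mulVec, spinS_mul_spinS, Pauli_succ_mul]
    rw [smul_spinS, ← WithLp.toLp_neg, ← Matrix.neg_mulVec, Matrix.fromBlocks_neg, neg_zero]

lemma toLp_opK {ψ : EuclideanSpace ℝ (Fin 3) → (Fin 2 ⊕ Fin 2) → ℂ}
    (hs : ContDiff ℝ (⊤ : ℕ∞) ψ) (x : EuclideanSpace ℝ (Fin 3)) :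
    WithLp.toLp 2 (opK ψ x) = spinOrbitK spinUnit (fun y => WithLp.toLp 2 (ψ y)) x := by
  have hd : ∀ j, rotDeriv j (fun y => WithLp.toLp 2 (ψ y)) x
      = WithLp.toLp 2 (rotDeriv j ψ x) := fun j => by
    have h := ((PiLp.continuousLinearEquiv 2 ℝ (fun _ : Fin 2 ⊕ Fin 2 => ℂ)).symm.hasFDerivAt.comp x
      (hs.differentiable (by simp) x).hasFDerivAt).fderiv
    unfold rotDeriv
    exact DFunLike.congr_fun h (rotGen j x)
  have hang : ∀ j, angL j ψ x = (-Complex.I) • rotDeriv j ψ x := fun j => by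
    simp only [angL, pd, rotDeriv, rotGen_apply, map_sub, map_smul, Complex.coe_smul]
  simp only [opK, spinOrbitK, spinOrbit, hd, hang, spinUnit_apply, ← WithLp.toLp_sum,
    ← WithLp.toLp_add, Finset.smul_sum, Matrix.mulVec_smul, Matrix.smul_mulVec, smul_smul]
  simp only [mul_comm]

end DiracSpinors

/-- **Spin-orbit Hardy-type comparison.** For `ψ ∈ C_c^∞(ℝ³ \ {0})⁴`,
`∫ |ψ|²/|x| ≤ ∫ |(1+2S·L)ψ|²/|x|`, with equality if and only if all partial wave
components of `ψ` with `k_j ≠ ±1` vanish — equivalently (since `(1+2S·L)² ` has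
eigenvalue `k_j²` on the `k_j` partial wave space), iff `(1+2S·L)²ψ = ψ`. -/
theorem stmt_12 (ψ : EuclideanSpace ℝ (Fin 3) → (Fin 2 ⊕ Fin 2) → ℂ)
    (hs : ContDiff ℝ (⊤ : ℕ∞) ψ) (hc : HasCompactSupport ψ) (h0 : 0 ∉ tsupport ψ) :
    (∫ x : EuclideanSpace ℝ (Fin 3), (∑ i, ‖ψ x i‖ ^ 2) / ‖x‖)
      ≤ ∫ x : EuclideanSpace ℝ (Fin 3), (∑ i, ‖opK ψ x i‖ ^ 2) / ‖x‖ ∧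
    ((∫ x : EuclideanSpace ℝ (Fin 3), (∑ i, ‖ψ x i‖ ^ 2) / ‖x‖)
        = (∫ x : EuclideanSpace ℝ (Fin 3), (∑ i, ‖opK ψ x i‖ ^ 2) / ‖x‖)
      ↔ ∀ x : EuclideanSpace ℝ (Fin 3), opK (fun y => opK ψ y) x = ψ x) := by
  have hf : SmoothOnlyOn (tsupport ψ) (fun y => WithLp.toLp 2 (ψ y)) :=
    ⟨(PiLp.continuousLinearEquiv 2 ℝ (fun _ : Fin 2 ⊕ Fin 2 => ℂ)).symm.contDiff.comp hs,
      fun x hx => by rw [image_eq_zero_of_notMem_tsupport hx]; rfl⟩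
  have hK : (fun y => WithLp.toLp 2 (opK ψ y)) = spinOrbitK spinUnit fun y => WithLp.toLp 2 (ψ y) :=
    funext (toLp_opK hs)
  have hKs : ContDiff ℝ (⊤ : ℕ∞) (opK ψ) := by
    have h := (hf.spinOrbitK (T := spinUnit) (isClosed_tsupport ψ)).contDiff
    rw [← hK] at h
    exact (PiLp.continuousLinearEquiv 2 ℝ (fun _ : Fin 2 ⊕ Fin 2 => ℂ)).contDiff.comp h
  have hw : ∀ φ : EuclideanSpace ℝ (Fin 3) → (Fin 2 ⊕ Fin 2) → ℂ,
      ∫ x : EuclideanSpace ℝ (Fin 3), (∑ i, ‖φ x i‖ ^ 2) / ‖x‖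
        = wInner (fun y => WithLp.toLp 2 (φ y)) (fun y => WithLp.toLp 2 (φ y)) := fun φ => by
    simp only [wInner, PiLp.inner_apply, real_inner_self_eq_norm_sq]
  rw [hw ψ, hw (opK ψ), hK]
  refine ⟨wInner_self_le_spinOrbitK isQuaternionic_spinUnit hc h0 hf, ?_⟩
  rw [wInner_self_eq_spinOrbitK_iff isQuaternionic_spinUnit hc h0 hf, ← hK]
  refine forall_congr' fun x => ?_
  rw [← toLp_opK hKs]
  exact (WithLp.toLp_injective 2).eq_iff
end
end

section
/- Let m > 0, a ∈ (−m, m). For every ψ ∈ C_c^∞(ℝ³ \ {0})⁴, the Hardy-type inequality ((m²−a²)/m²) ∫_{ℝ³} |ψ|²/|x| dx ≤ ∫_{ℝ³} |(−i α·∇ + mβ − a)ψ|² |x| dx holds. -/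
open Matrix MeasureTheory

noncomputable section

open scoped ContDiff

/-- Smooth real functions with compact support in `ℝ³ \ {0}`. -/
structure IsTest (f : EuclideanSpace ℝ (Fin 3) → ℝ) : Prop where
  smooth : ContDiff ℝ ∞ f
  compact : HasCompactSupport f
  zero_notMem : 0 ∉ tsupport f

/-- Integrable functions with vanishing integral. -/
def IsNull (f : EuclideanSpace ℝ (Fin 3) → ℝ) : Prop :=
  Integrable f ∧ ∫ x, f x = 0

/-- The `j`-th partial derivative of a scalar function. -/
def partialD (j : Fin 3) (f : EuclideanSpace ℝ (Fin 3) → ℝ)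
    (x : EuclideanSpace ℝ (Fin 3)) : ℝ :=
  fderiv ℝ f x (EuclideanSpace.single j 1)

/-- The components of the angular vector field `x ∧ ∇`. -/
def angD (j : Fin 3) (f : EuclideanSpace ℝ (Fin 3) → ℝ)
    (x : EuclideanSpace ℝ (Fin 3)) : ℝ :=
  x (j + 1) * partialD (j + 2) f x - x (j + 2) * partialD (j + 1) f x

/-- The Euler vector field `x · ∇`. -/
def eulerD (f : EuclideanSpace ℝ (Fin 3) → ℝ) (x : EuclideanSpace ℝ (Fin 3)) : ℝ :=
  ∑ j, x j * partialD j f x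

namespace IsNull

variable {f g : EuclideanSpace ℝ (Fin 3) → ℝ}

lemma add (hf : IsNull f) (hg : IsNull g) : IsNull fun x => f x + g x :=
  ⟨hf.1.add hg.1, by rw [integral_add hf.1 hg.1, hf.2, hg.2, add_zero]⟩

lemma sub (hf : IsNull f) (hg : IsNull g) : IsNull fun x => f x - g x :=
  ⟨hf.1.sub hg.1, by rw [integral_sub hf.1 hg.1, hf.2, hg.2, sub_zero]⟩

lemma const_mul (c : ℝ) (hf : IsNull f) : IsNull fun x => c * f x :=
  ⟨hf.1.const_mul c, by rw [integral_const_mul, hf.2, mul_zero]⟩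

lemma congr (hf : IsNull f) (h : ∀ x, f x = g x) : IsNull g := by
  rwa [← funext h]

lemma sum {ι : Type*} (s : Finset ι) {F : ι → EuclideanSpace ℝ (Fin 3) → ℝ}
    (h : ∀ i ∈ s, IsNull (F i)) : IsNull fun x => ∑ i ∈ s, F i x := by
  refine ⟨integrable_finsetSum s fun i hi => (h i hi).1, ?_⟩
  rw [integral_finsetSum s fun i hi => (h i hi).1]
  exact Finset.sum_eq_zero fun i hi => (h i hi).2

end IsNull

namespace IsTest

variable {f g : EuclideanSpace ℝ (Fin 3) → ℝ}

lemma differentiableAt (hf : IsTest f) (x : EuclideanSpace ℝ (Fin 3)) : DifferentiableAt ℝ f x :=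
  hf.smooth.differentiable (by simp) x

lemma integrable (hf : IsTest f) : Integrable f :=
  hf.smooth.continuous.integrable_of_hasCompactSupport hf.compact

lemma apply_zero (hf : IsTest f) : f 0 = 0 := image_eq_zero_of_notMem_tsupport hf.zero_notMem

lemma smooth_mul (hg : ContDiff ℝ ∞ g) (hf : IsTest f) : IsTest fun x => g x * f x where
  smooth := hg.mul hf.smooth
  compact := hf.compact.mul_left
  zero_notMem h := hf.zero_notMem (tsupport_mul_subset_right h)

lemma mul (hf : IsTest f) (hg : IsTest g) : IsTest fun x => f x * g x := hg.smooth_mul hf.smooth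

lemma coord_mul (k : Fin 3) (hf : IsTest f) : IsTest fun x => x k * f x :=
  hf.smooth_mul (by fun_prop)

lemma add (hf : IsTest f) (hg : IsTest g) : IsTest fun x => f x + g x where
  smooth := hf.smooth.add hg.smooth
  compact := hf.compact.add hg.compact
  zero_notMem h := (tsupport_add f g h).elim hf.zero_notMem hg.zero_notMem

lemma const_mul (c : ℝ) (hf : IsTest f) : IsTest fun x => c * f x :=
  hf.smooth_mul contDiff_const

lemma sub (hf : IsTest f) (hg : IsTest g) : IsTest fun x => f x - g x := by
  simpa [sub_eq_add_neg] using hf.add (hg.const_mul (-1))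

lemma partialD (j : Fin 3) (hf : IsTest f) : IsTest (partialD j f) where
  smooth := (hf.smooth.fderiv_right (m := ∞) (by simp)).clm_apply contDiff_const
  compact := hf.compact.fderiv_apply ℝ _
  zero_notMem h := hf.zero_notMem (tsupport_fderiv_apply_subset ℝ _ h)

lemma angD (j : Fin 3) (hf : IsTest f) : IsTest (angD j f) :=
  ((hf.partialD _).coord_mul _).sub ((hf.partialD _).coord_mul _)

lemma eulerD (hf : IsTest f) : IsTest (eulerD f) := by
  have := (((hf.partialD 0).coord_mul 0).add ((hf.partialD 1).coord_mul 1)).add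
    ((hf.partialD 2).coord_mul 2)
  convert this using 2 with x
  simp [_root_.eulerD, Fin.sum_univ_three]

lemma div_norm (hf : IsTest f) : IsTest fun x => f x / ‖x‖ where
  smooth := by
    rw [contDiff_iff_contDiffAt]
    intro x
    by_cases hx : x = 0
    · have h : f =ᶠ[nhds x] 0 :=
        notMem_tsupport_iff_eventuallyEq.1 (hx ▸ hf.zero_notMem)
      refine (contDiffAt_const (c := (0 : ℝ))).congr_of_eventuallyEq ?_
      filter_upwards [h] with y hy
      simp [hy]
    · exact hf.smooth.contDiffAt.div (contDiffAt_norm ℝ hx) (by simpa using hx)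
  compact := hf.compact.mono fun x hx h => hx (by simp [h])
  zero_notMem h := hf.zero_notMem <|
    tsupport_mul_subset_left (f := f) (g := fun x => ‖x‖⁻¹) (by simpa [div_eq_mul_inv] using! h)

lemma isNull_partialD (j : Fin 3) (hf : IsTest f) : IsNull (_root_.partialD j f) := by
  refine ⟨(hf.partialD j).integrable, ?_⟩
  have h := integral_mul_fderiv_eq_neg_fderiv_mul_of_integrable (𝕜 := ℝ)
    (f := fun _ : EuclideanSpace ℝ (Fin 3) => (1 : ℝ)) (g := f)
    (v := EuclideanSpace.single j 1) (μ := volume) (by simp)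
    (by simpa using! (hf.partialD j).integrable) (by simpa using hf.integrable)
    (by simp) (fun x _ => hf.differentiableAt x)
  simpa [_root_.partialD] using h

lemma partialD_comm (i j : Fin 3) (hf : IsTest f) (x : EuclideanSpace ℝ (Fin 3)) :
    _root_.partialD i (_root_.partialD j f) x = _root_.partialD j (_root_.partialD i f) x := by
  have hd : DifferentiableAt ℝ (fderiv ℝ f) x :=
    (hf.smooth.fderiv_right (m := ∞) (by simp)).differentiable (by simp) x
  have hs : IsSymmSndFDerivAt ℝ f x :=
    hf.smooth.contDiffAt.isSymmSndFDerivAt (by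
      simpa using WithTop.coe_le_coe.2 (le_top : (2 : ℕ∞) ≤ ⊤))
  unfold _root_.partialD
  rw [fderiv_clm_apply hd (by fun_prop), fderiv_clm_apply hd (by fun_prop)]
  simpa using hs _ _

end IsTest

variable {f g : EuclideanSpace ℝ (Fin 3) → ℝ} {x : EuclideanSpace ℝ (Fin 3)}

lemma partialD_mul (j : Fin 3) (hf : DifferentiableAt ℝ f x) (hg : DifferentiableAt ℝ g x) :
    partialD j (fun y => f y * g y) x = f x * partialD j g x + g x * partialD j f x := by
  simp [partialD, fderiv_fun_mul hf hg]

lemma partialD_sub (j : Fin 3) (hf : DifferentiableAt ℝ f x) (hg : DifferentiableAt ℝ g x) :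
    partialD j (fun y => f y - g y) x = partialD j f x - partialD j g x := by
  simp [partialD, fderiv_fun_sub hf hg]

lemma partialD_add (j : Fin 3) (hf : DifferentiableAt ℝ f x) (hg : DifferentiableAt ℝ g x) :
    partialD j (fun y => f y + g y) x = partialD j f x + partialD j g x := by
  simp [partialD, fderiv_fun_add hf hg]

lemma partialD_coord (j k : Fin 3) :
    partialD j (fun y => y k) x = if k = j then 1 else 0 := by
  have h : HasFDerivAt (fun y : EuclideanSpace ℝ (Fin 3) => y k)
      (EuclideanSpace.proj k : EuclideanSpace ℝ (Fin 3) →L[ℝ] ℝ) x :=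
    (EuclideanSpace.proj k : EuclideanSpace ℝ (Fin 3) →L[ℝ] ℝ).hasFDerivAt
  simp [partialD, h.fderiv]

lemma partialD_coord_mul (j k : Fin 3) (hf : DifferentiableAt ℝ f x) :
    partialD j (fun y => y k * f y) x = x k * partialD j f x + if k = j then f x else 0 := by
  rw [partialD_mul j (by fun_prop) hf, partialD_coord]
  simp

lemma IsTest.partialD_div_norm (j : Fin 3) (hf : IsTest f) (x : EuclideanSpace ℝ (Fin 3)) :
    _root_.partialD j (fun y => f y / ‖y‖) x
      = _root_.partialD j f x / ‖x‖ - x j * f x / ‖x‖ ^ 3 := by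
  by_cases hx : x = 0
  · subst hx
    simpa using (hf.div_norm.partialD j).apply_zero
  · have hn : ‖x‖ ≠ 0 := by simpa using hx
    have h1 := (hf.div_norm.differentiableAt x).hasFDerivAt
    have h2 : HasFDerivAt (fun y : EuclideanSpace ℝ (Fin 3) => ‖y‖) (‖x‖⁻¹ • innerSL ℝ x) x := by
      have := (hasStrictFDerivAt_norm_sq x).hasFDerivAt.sqrt (by positivity)
      simp only [norm_nonneg, Real.sqrt_sq] at this
      refine this.congr_fderiv ?_
      ext v
      simp only [_root_.smul_apply, smul_eq_mul, nsmul_eq_mul]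
      field_simp
      norm_num
    have h3 : f = fun y => f y / ‖y‖ * ‖y‖ := by
      ext y
      by_cases hy : y = 0
      · simp [hy, hf.apply_zero]
      · have : ‖y‖ ≠ 0 := by simpa using hy
        field_simp
    have h4 := ((h1.mul h2).congr_of_eventuallyEq (.of_eq h3)).fderiv
    have h5 : _root_.partialD j f x = ‖x‖ * _root_.partialD j (fun y => f y / ‖y‖) x
        + f x / ‖x‖ * (‖x‖⁻¹ * x j) := by
      conv_lhs => rw [_root_.partialD, h4]
      simp [_root_.partialD, EuclideanSpace.inner_single_right]
      ring
    rw [h5]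
    field_simp
    ring

lemma angD_mul (j : Fin 3) (hf : DifferentiableAt ℝ f x) (hg : DifferentiableAt ℝ g x) :
    angD j (fun y => f y * g y) x = f x * angD j g x + g x * angD j f x := by
  simp only [angD, partialD_mul _ hf hg]
  ring

lemma eulerD_mul (hf : DifferentiableAt ℝ f x) (hg : DifferentiableAt ℝ g x) :
    eulerD (fun y => f y * g y) x = f x * eulerD g x + g x * eulerD f x := by
  simp only [eulerD, partialD_mul _ hf hg, Fin.sum_univ_three]
  ring

lemma norm_sq_eq_coord (x : EuclideanSpace ℝ (Fin 3)) :
    ‖x‖ ^ 2 = x 0 ^ 2 + x 1 ^ 2 + x 2 ^ 2 := by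
  simp [EuclideanSpace.norm_sq_eq, Fin.sum_univ_three]

namespace IsTest

lemma partialD_angD (i j : Fin 3) (hf : IsTest f) (x : EuclideanSpace ℝ (Fin 3)) :
    _root_.partialD i (_root_.angD j f) x =
      (x (j + 1) * _root_.partialD i (_root_.partialD (j + 2) f) x
        + if j + 1 = i then _root_.partialD (j + 2) f x else 0)
      - (x (j + 2) * _root_.partialD i (_root_.partialD (j + 1) f) x
        + if j + 2 = i then _root_.partialD (j + 1) f x else 0) := by
  rw [← partialD_coord_mul i _ ((hf.partialD (j + 2)).differentiableAt x),
    ← partialD_coord_mul i _ ((hf.partialD (j + 1)).differentiableAt x),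
    ← partialD_sub i (((hf.partialD _).coord_mul _).differentiableAt x)
      (((hf.partialD _).coord_mul _).differentiableAt x)]
  rfl

lemma partialD_eulerD (i : Fin 3) (hf : IsTest f) (x : EuclideanSpace ℝ (Fin 3)) :
    _root_.partialD i (_root_.eulerD f) x =
      ∑ j, x j * _root_.partialD i (_root_.partialD j f) x + _root_.partialD i f x := by
  have h (j : Fin 3) : DifferentiableAt ℝ (fun y => y j * _root_.partialD j f y) x :=
    ((hf.partialD j).coord_mul j).differentiableAt x
  have he : _root_.eulerD f = fun y => y 0 * _root_.partialD 0 f y + y 1 * _root_.partialD 1 f y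
      + y 2 * _root_.partialD 2 f y := by
    ext y
    simp [_root_.eulerD, Fin.sum_univ_three]
  rw [he, partialD_add i ((h 0).fun_add (h 1)) (h 2), partialD_add i (h 0) (h 1)]
  simp only [partialD_coord_mul i _ ((hf.partialD _).differentiableAt x), Fin.sum_univ_three]
  fin_cases i <;> simp <;> ring

lemma eulerD_angD (j : Fin 3) (hf : IsTest f) (x : EuclideanSpace ℝ (Fin 3)) :
    _root_.eulerD (_root_.angD j f) x = _root_.angD j (_root_.eulerD f) x := by
  have h10 := hf.partialD_comm 1 0 x
  have h20 := hf.partialD_comm 2 0 x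
  have h21 := hf.partialD_comm 2 1 x
  rw [_root_.eulerD]
  conv_rhs => rw [_root_.angD]
  simp only [hf.partialD_angD, hf.partialD_eulerD, Fin.sum_univ_three]
  fin_cases j <;> simp [h10, h20, h21] <;> ring

/-- The commutation relation `[Λ_j, Λ_{j+1}] = -Λ_{j+2}` of the angular vector fields. -/
lemma angD_angD (j : Fin 3) (hf : IsTest f) (x : EuclideanSpace ℝ (Fin 3)) :
    _root_.angD (j + 1) (_root_.angD j f) x - _root_.angD j (_root_.angD (j + 1) f) x
      = _root_.angD (j + 2) f x := by
  have h10 := hf.partialD_comm 1 0 x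
  have h20 := hf.partialD_comm 2 0 x
  have h21 := hf.partialD_comm 2 1 x
  have h (i k : Fin 3) (g : EuclideanSpace ℝ (Fin 3) → ℝ) : _root_.angD i (_root_.angD k g) x =
      x (i + 1) * _root_.partialD (i + 2) (_root_.angD k g) x
        - x (i + 2) * _root_.partialD (i + 1) (_root_.angD k g) x := rfl
  simp only [h, hf.partialD_angD]
  fin_cases j <;> simp [h10, h20, h21, _root_.angD] <;> ring

lemma isNull_angD (j : Fin 3) (hf : IsTest f) : IsNull fun x => _root_.angD j f x / ‖x‖ := by
  have hg := hf.div_norm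
  refine ((hg.coord_mul (j + 1)).isNull_partialD (j + 2)).sub
    ((hg.coord_mul (j + 2)).isNull_partialD (j + 1)) |>.congr fun x => ?_
  simp only [partialD_coord_mul _ _ (hg.differentiableAt x), hf.partialD_div_norm, _root_.angD]
  fin_cases j <;> simp <;> ring

lemma isNull_eulerD (hf : IsTest f) :
    IsNull fun x => (_root_.eulerD f x + 2 * f x) / ‖x‖ := by
  have hg := hf.div_norm
  refine IsNull.sum Finset.univ
    (fun j _ => (hg.coord_mul j).isNull_partialD j) |>.congr fun x => ?_
  simp only [partialD_coord_mul _ _ (hg.differentiableAt x), hf.partialD_div_norm, _root_.eulerD,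
    Fin.sum_univ_three]
  by_cases hx : x = 0
  · simp [hx]
  · have hn : ‖x‖ ≠ 0 := by simpa using hx
    simp only [if_true]
    field_simp
    linear_combination f x * norm_sq_eq_coord x

lemma isNull_eulerD_self (hf : IsTest f) :
    IsNull fun x => (_root_.eulerD f x + f x) * f x / ‖x‖ := by
  refine ((hf.mul hf).isNull_eulerD).const_mul (1 / 2) |>.congr fun x => ?_
  rw [eulerD_mul (hf.differentiableAt x) (hf.differentiableAt x)]
  ring

lemma isNull_eulerD_angD (j : Fin 3) (hf : IsTest f) (hg : IsTest g) :
    IsNull fun x => ((_root_.eulerD f x + f x) * _root_.angD j g x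
      - (_root_.eulerD g x + g x) * _root_.angD j f x) / ‖x‖ := by
  refine (((hf.mul (hg.angD j)).isNull_eulerD).sub ((hf.mul hg.eulerD).isNull_angD j)).sub
    ((hf.mul hg).isNull_angD j) |>.congr fun x => ?_
  rw [eulerD_mul (hf.differentiableAt x) ((hg.angD j).differentiableAt x),
    angD_mul j (hf.differentiableAt x) (hg.eulerD.differentiableAt x),
    angD_mul j (hf.differentiableAt x) (hg.differentiableAt x), hg.eulerD_angD]
  ring

lemma isNull_angD_angD (j : Fin 3) (hf : IsTest f) (hg : IsTest g) :
    IsNull fun x => (_root_.angD j f x * _root_.angD (j + 1) g x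
      - _root_.angD (j + 1) f x * _root_.angD j g x
      - (f x * _root_.angD (j + 2) g x - g x * _root_.angD (j + 2) f x) / 2) / ‖x‖ := by
  refine (((hf.mul (hg.angD (j + 1))).isNull_angD j).sub
    ((hf.mul (hg.angD j)).isNull_angD (j + 1))).add
    (((hf.mul hg).isNull_angD (j + 2)).const_mul (1 / 2)) |>.congr fun x => ?_
  rw [angD_mul _ (hf.differentiableAt x) ((hg.angD _).differentiableAt x),
    angD_mul _ (hf.differentiableAt x) ((hg.angD _).differentiableAt x),
    angD_mul _ (hf.differentiableAt x) (hg.differentiableAt x), ← hg.angD_angD]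
  ring

lemma isNull_coord_angD (l : Fin 3) (hf : IsTest f) (hg : IsTest g) :
    IsNull fun x => (x (l + 1) * (f x * _root_.angD (l + 2) g x + g x * _root_.angD (l + 2) f x)
      - x (l + 2) * (f x * _root_.angD (l + 1) g x + g x * _root_.angD (l + 1) f x)
      + 2 * x l * (f x * g x)) / ‖x‖ := by
  refine (((hf.mul hg).coord_mul (l + 1)).isNull_angD (l + 2)).sub
    (((hf.mul hg).coord_mul (l + 2)).isNull_angD (l + 1)) |>.congr fun x => ?_
  have h := (hf.mul hg).differentiableAt x
  rw [← angD_mul _ (hf.differentiableAt x) (hg.differentiableAt x),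
    ← angD_mul _ (hf.differentiableAt x) (hg.differentiableAt x)]
  simp only [_root_.angD, partialD_coord_mul _ _ h]
  fin_cases l <;> simp <;> ring

end IsTest

/-- The contraction `-i ∑ σ_j v_j` of three two-spinors `v_j`, where a two-spinor `(p, q)` is
encoded by the real vector `(re p, im p, re q, im q)`. -/
def spinMix (v : Fin 3 → Fin 4 → ℝ) : Fin 4 → ℝ :=
  ![v 2 1 + v 0 3 - v 1 2, -v 2 0 - v 0 2 - v 1 3, v 0 1 + v 1 0 - v 2 3,
    -v 0 0 + v 1 1 + v 2 2]

/-- The spin-orbit operator `1 + σ · L` on two-spinors, in real coordinates. -/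
def spinK (u : Fin 4 → EuclideanSpace ℝ (Fin 3) → ℝ) (x : EuclideanSpace ℝ (Fin 3)) :
    Fin 4 → ℝ :=
  fun c => u c x + spinMix (fun j c => angD j (u c) x) c

/-- The operator `i σ · x` on two-spinors, in real coordinates. -/
def spinPos (u : Fin 4 → EuclideanSpace ℝ (Fin 3) → ℝ) (x : EuclideanSpace ℝ (Fin 3)) :
    Fin 4 → ℝ :=
  fun c => -spinMix (fun j c => x j * u c x) c

section TwoSpinors

variable {u w : Fin 4 → EuclideanSpace ℝ (Fin 3) → ℝ}

lemma isNull_eulerD_mul_spinK (hu : ∀ c, IsTest (u c)) :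
    IsNull fun x => (∑ c, (eulerD (u c) x + u c x) * spinK u x c) / ‖x‖ := by
  have h (j : Fin 3) (c d : Fin 4) := (hu c).isNull_eulerD_angD j (hu d)
  have h0 := IsNull.sum Finset.univ fun c _ => (hu c).isNull_eulerD_self
  refine (((((h0.add (h 2 0 1)).add (h 0 0 3)).sub (h 1 0 2)).sub (h 0 1 2)).sub
    (h 1 1 3)).sub (h 2 2 3) |>.congr fun x => ?_
  simp [Fin.sum_univ_four, spinK, spinMix]
  ring

lemma isNull_spinPos_mul_spinK (hu : ∀ c, IsTest (u c)) (hw : ∀ c, IsTest (w c)) :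
    IsNull fun x =>
      (∑ c, (spinPos w x c * spinK u x c - spinPos u x c * spinK w x c)) / ‖x‖ := by
  have h (l : Fin 3) (c d : Fin 4) := (hw c).isNull_coord_angD l (hu d)
  refine (((((h 0 0 3).sub (h 0 1 2)).add (h 0 2 1)).sub (h 0 3 0)).add
    ((((h 1 2 0).sub (h 1 0 2)).sub (h 1 1 3)).add (h 1 3 1))).add
    ((((h 2 0 1).sub (h 2 1 0)).sub (h 2 2 3)).add (h 2 3 2)) |>.congr fun x => ?_
  simp [Fin.sum_univ_four, spinK, spinMix, spinPos, angD]
  ring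

/-- The twistor inequality: the Clifford contraction of a tangential family of spinors. -/
lemma sum_spinMix_sq_le {x : Fin 3 → ℝ} (hx : 0 < x 0 ^ 2 + x 1 ^ 2 + x 2 ^ 2)
    (v : Fin 3 → Fin 4 → ℝ) (hv : ∀ c, x 0 * v 0 c + x 1 * v 1 c + x 2 * v 2 c = 0) :
    ∑ c, spinMix v c ^ 2 ≤ 2 * ∑ j, ∑ c, v j c ^ 2 := by
  obtain ⟨R, hR⟩ : ∃ R, R = x 0 ^ 2 + x 1 ^ 2 + x 2 ^ 2 := ⟨_, rfl⟩
  rw [← hR] at hx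
  have key (y : Fin 4 → ℝ) :
      ∑ j, ∑ c, (2 * R * v j c + R * spinMix (fun k d => if k = j then y d else 0) c
        - x j * spinMix (fun k d => x k * y d) c) ^ 2
      = 2 * R ^ 2 * (2 * (∑ j, ∑ c, v j c ^ 2) - 2 * (∑ c, spinMix v c * y c) + ∑ c, y c ^ 2) := by
    have h0 := hv 0
    have h1 := hv 1
    have h2 := hv 2
    have h3 := hv 3
    simp [Fin.sum_univ_four, Fin.sum_univ_three, spinMix]
    linear_combination (-4 * R) * ((x 2 * y 1 + x 0 * y 3 - x 1 * y 2) * h0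
      + (-(x 2 * y 0) - x 0 * y 2 - x 1 * y 3) * h1 + (x 0 * y 1 + x 1 * y 0 - x 2 * y 3) * h2
      + (-(x 0 * y 0) + x 1 * y 1 + x 2 * y 2) * h3)
      - (y 0 ^ 2 + y 1 ^ 2 + y 2 ^ 2 + y 3 ^ 2) * (-R + x 0 ^ 2 + x 1 ^ 2 + x 2 ^ 2) * hR
  have h := key (spinMix v)
  have hs : 0 ≤ 2 * R ^ 2 * (2 * (∑ j, ∑ c, v j c ^ 2) - 2 * (∑ c, spinMix v c * spinMix v c)
      + ∑ c, spinMix v c ^ 2) := h ▸ by positivity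
  have := nonneg_of_mul_nonneg_right hs (by positivity)
  simp only [← sq] at this
  linarith

/-- The spin-orbit operator is bounded below by one in modulus, up to a null function. -/
lemma exists_isNull_le_spinK (hu : ∀ c, IsTest (u c)) :
    ∃ G, IsNull G ∧ ∀ x, G x ≤ (∑ c, spinK u x c ^ 2 - ∑ c, u c x ^ 2) / ‖x‖ := by
  have h (j : Fin 3) (c d : Fin 4) := (hu c).isNull_angD_angD j (hu d)
  refine ⟨_, (((((h 2 1 3).sub (h 1 2 1)).sub (h 0 3 2)).add (h 2 0 2)).sub (h 1 0 3)).add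
    (h 0 1 0) |>.const_mul 4, fun x => ?_⟩
  by_cases hx : x = 0
  · simp [hx]
  have hn : 0 < ‖x‖ := by simpa using hx
  have ht := sum_spinMix_sq_le (x := x) (by rw [← norm_sq_eq_coord]; positivity)
    (fun j c => angD j (u c) x) (fun c => by simp [angD]; ring)
  rw [← sub_nonneg]
  refine le_of_le_of_eq (div_nonneg (sub_nonneg.2 ht) hn.le) ?_
  simp [Fin.sum_univ_four, Fin.sum_univ_three, spinK, spinMix]
  ring

/-- The factorization `(σ · x)(σ · ∇) = x · ∇ - σ · L` in real coordinates. -/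
lemma norm_sq_mul_sum_spinMix (k : ℝ) (x : EuclideanSpace ℝ (Fin 3)) :
    ‖x‖ ^ 2 * ∑ c, (spinMix (fun j c => partialD j (w c) x) c + k * u c x) ^ 2
      = ∑ c, (eulerD (w c) x + w c x - spinK w x c + k * spinPos u x c) ^ 2 := by
  rw [norm_sq_eq_coord]
  simp [Fin.sum_univ_four, Fin.sum_univ_three, spinK, spinMix, spinPos, angD, eulerD]
  ring

end TwoSpinors

/-- The Dirac–Hardy inequality in real coordinates, up to a null function. -/
lemma exists_isNull_le_dirac {m a : ℝ} (hm : 0 < m) (ha : a ∈ Set.Ioo (-m) m)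
    {u w : Fin 4 → EuclideanSpace ℝ (Fin 3) → ℝ}
    (hu : ∀ c, IsTest (u c)) (hw : ∀ c, IsTest (w c)) :
    ∃ G, IsNull G ∧ ∀ x,
      G x + (m ^ 2 - a ^ 2) / m ^ 2 * ((∑ c, u c x ^ 2 + ∑ c, w c x ^ 2) / ‖x‖)
      ≤ (∑ c, (spinMix (fun j c => partialD j (w c) x) c + (m - a) * u c x) ^ 2
        + ∑ c, (spinMix (fun j c => partialD j (u c) x) c + -(m + a) * w c x) ^ 2) * ‖x‖ := by
  obtain ⟨Gu, hGu, hGu'⟩ := exists_isNull_le_spinK hu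
  obtain ⟨Gw, hGw, hGw'⟩ := exists_isNull_le_spinK hw
  obtain ⟨t, ht⟩ : ∃ t, t = a / m := ⟨_, rfl⟩
  have hat : a = t * m := by rw [ht]; field_simp
  have ht2 : (m ^ 2 - a ^ 2) / m ^ 2 = 1 - t ^ 2 := by rw [hat]; field_simp
  have htpos : 0 ≤ 1 - t ^ 2 := by
    rw [← ht2]
    have : 0 ≤ m ^ 2 - a ^ 2 := by nlinarith [ha.1, ha.2]
    positivity
  have key (k s : ℝ) {u w : Fin 4 → EuclideanSpace ℝ (Fin 3) → ℝ}
      {x : EuclideanSpace ℝ (Fin 3)} (hx : 0 < ‖x‖) :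
      (1 - s ^ 2) * ((∑ c, spinK w x c ^ 2) / ‖x‖)
        - 2 * (1 + s) * ((∑ c, (eulerD (w c) x + w c x) * spinK w x c) / ‖x‖)
        - 2 * (1 + s) * k * ((∑ c, spinPos u x c * spinK w x c) / ‖x‖)
      ≤ (∑ c, (spinMix (fun j c => partialD j (w c) x) c + k * u c x) ^ 2) * ‖x‖ := by
    have h1 : (∑ c, (spinMix (fun j c => partialD j (w c) x) c + k * u c x) ^ 2) * ‖x‖
        = (∑ c, (eulerD (w c) x + w c x - spinK w x c + k * spinPos u x c) ^ 2) / ‖x‖ := by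
      rw [← norm_sq_mul_sum_spinMix]
      field_simp
    have h2 : 0 ≤ (∑ c, (eulerD (w c) x + w c x + s * spinK w x c + k * spinPos u x c) ^ 2) / ‖x‖ :=
      by positivity
    rw [h1, ← sub_nonneg]
    refine le_of_le_of_eq h2 ?_
    simp only [Fin.sum_univ_four]
    ring
  refine ⟨_, ((((hGu.add hGw).const_mul (1 - t ^ 2)).sub
    ((isNull_eulerD_mul_spinK hw).const_mul (2 * (1 + t)))).sub
    ((isNull_eulerD_mul_spinK hu).const_mul (2 * (1 - t)))).add
    ((isNull_spinPos_mul_spinK hu hw).const_mul (2 * (1 - t ^ 2) * m)), fun x => ?_⟩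
  rw [ht2]
  have hu' := mul_le_mul_of_nonneg_left (hGu' x) htpos
  have hw' := mul_le_mul_of_nonneg_left (hGw' x) htpos
  by_cases hx : x = 0
  · subst hx
    simp only [norm_zero, div_zero, mul_zero] at hu' hw' ⊢
    linarith
  have hn : 0 < ‖x‖ := by simpa using hx
  have k1 := key (m - a) t (u := u) (w := w) hn
  have k2 := key (-(m + a)) (-t) (u := w) (w := u) hn
  subst hat
  rw [Finset.sum_sub_distrib, add_mul]
  refine le_trans ?_ (add_le_add k1 k2)
  rw [sub_div] at hu' hw' ⊢
  rw [add_div]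
  linarith

/-- The real coordinates of the two-spinor formed by the components `i` and `j` of `ψ`. -/
def realCoords (ψ : EuclideanSpace ℝ (Fin 3) → (Fin 2 ⊕ Fin 2) → ℂ) (i j : Fin 2 ⊕ Fin 2) :
    Fin 4 → EuclideanSpace ℝ (Fin 3) → ℝ :=
  ![fun x => (ψ x i).re, fun x => (ψ x i).im, fun x => (ψ x j).re, fun x => (ψ x j).im]

section RealCoords

variable {ψ : EuclideanSpace ℝ (Fin 3) → (Fin 2 ⊕ Fin 2) → ℂ}

lemma isTest_clm_comp (hs : ContDiff ℝ ∞ ψ) (hc : HasCompactSupport ψ)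
    (h0 : 0 ∉ tsupport ψ) (L : ((Fin 2 ⊕ Fin 2) → ℂ) →L[ℝ] ℝ) : IsTest fun x => L (ψ x) where
  smooth := L.contDiff.comp hs
  compact := hc.comp_left (map_zero L)
  zero_notMem h := h0 (tsupport_comp_subset (map_zero L) ψ h)

lemma partialD_clm_comp (hs : ContDiff ℝ ∞ ψ) (L : ((Fin 2 ⊕ Fin 2) → ℂ) →L[ℝ] ℝ) (j : Fin 3)
    (x : EuclideanSpace ℝ (Fin 3)) : partialD j (fun y => L (ψ y)) x = L (pd j ψ x) := by
  have h : HasFDerivAt (fun y => L (ψ y)) (L.comp (fderiv ℝ ψ x)) x :=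
    L.hasFDerivAt.comp x (hs.differentiable (by simp) x).hasFDerivAt
  simp [partialD, h.fderiv, pd]

lemma isTest_realCoords (hs : ContDiff ℝ ∞ ψ) (hc : HasCompactSupport ψ)
    (h0 : 0 ∉ tsupport ψ) (i j : Fin 2 ⊕ Fin 2) (c : Fin 4) : IsTest (realCoords ψ i j c) := by
  have hre (i) := isTest_clm_comp hs hc h0 (Complex.reCLM.comp (ContinuousLinearMap.proj i))
  have him (i) := isTest_clm_comp hs hc h0 (Complex.imCLM.comp (ContinuousLinearMap.proj i))
  fin_cases c
  exacts [hre i, him i, hre j, him j]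

lemma partialD_re (hs : ContDiff ℝ ∞ ψ) (i : Fin 2 ⊕ Fin 2) (j : Fin 3)
    (x : EuclideanSpace ℝ (Fin 3)) : partialD j (fun y => (ψ y i).re) x = (pd j ψ x i).re :=
  partialD_clm_comp hs (Complex.reCLM.comp (ContinuousLinearMap.proj i)) j x

lemma partialD_im (hs : ContDiff ℝ ∞ ψ) (i : Fin 2 ⊕ Fin 2) (j : Fin 3)
    (x : EuclideanSpace ℝ (Fin 3)) : partialD j (fun y => (ψ y i).im) x = (pd j ψ x i).im :=
  partialD_clm_comp hs (Complex.imCLM.comp (ContinuousLinearMap.proj i)) j x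

lemma sum_norm_sq_eq_realCoords (x : EuclideanSpace ℝ (Fin 3)) :
    ∑ i, ‖ψ x i‖ ^ 2 = ∑ c, realCoords ψ (.inl 0) (.inl 1) c x ^ 2
      + ∑ c, realCoords ψ (.inr 0) (.inr 1) c x ^ 2 := by
  simp [Fin.sum_univ_four, realCoords, Complex.sq_norm, Complex.normSq_apply]
  ring

lemma sum_norm_sq_dirac_eq_realCoords (hs : ContDiff ℝ ∞ ψ) (m a : ℝ)
    (x : EuclideanSpace ℝ (Fin 3)) :
    ∑ i, ‖(diracKin ψ x + (m : ℂ) • diracBeta.mulVec (ψ x) - (a : ℂ) • ψ x) i‖ ^ 2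
      = ∑ c, (spinMix (fun j c => partialD j (realCoords ψ (.inr 0) (.inr 1) c) x) c
          + (m - a) * realCoords ψ (.inl 0) (.inl 1) c x) ^ 2
        + ∑ c, (spinMix (fun j c => partialD j (realCoords ψ (.inl 0) (.inl 1) c) x) c
          + -(m + a) * realCoords ψ (.inr 0) (.inr 1) c x) ^ 2 := by
  simp [Fin.sum_univ_four, Fin.sum_univ_three, realCoords, Complex.sq_norm, Complex.normSq_apply,
    spinMix, partialD_re hs, partialD_im hs, diracKin, diracBeta, diracAlpha, Pauli,
    Matrix.mulVec, dotProduct, Matrix.one_apply]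
  ring

end RealCoords

/-- **Hardy-type inequality for the Dirac operator (weak form).** For `m > 0`,
`a ∈ (-m, m)` and `ψ ∈ C_c^∞(ℝ³ \ {0})⁴`,
`((m²-a²)/m²) ∫ |ψ|²/|x| ≤ ∫ |(-i α·∇ + mβ - a)ψ|² |x|`. -/
theorem stmt_13 (m a : ℝ) (hm : 0 < m) (ha : a ∈ Set.Ioo (-m) m)
    (ψ : EuclideanSpace ℝ (Fin 3) → (Fin 2 ⊕ Fin 2) → ℂ)
    (hs : ContDiff ℝ (⊤ : ℕ∞) ψ) (hc : HasCompactSupport ψ) (h0 : 0 ∉ tsupport ψ) :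
    ((m ^ 2 - a ^ 2) / m ^ 2) *
        ∫ x : EuclideanSpace ℝ (Fin 3), (∑ i, ‖ψ x i‖ ^ 2) / ‖x‖
      ≤ ∫ x : EuclideanSpace ℝ (Fin 3),
          (∑ i, ‖(diracKin ψ x + (m : ℂ) • diracBeta.mulVec (ψ x) - (a : ℂ) • ψ x) i‖ ^ 2)
            * ‖x‖ := by
  have hu := isTest_realCoords hs hc h0 (.inl 0) (.inl 1)
  have hw := isTest_realCoords hs hc h0 (.inr 0) (.inr 1)
  obtain ⟨G, hG, hle⟩ := exists_isNull_le_dirac hm ha hu hw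
  simp only [← sum_norm_sq_eq_realCoords, ← sum_norm_sq_dirac_eq_realCoords hs] at hle
  have hL : Integrable fun x : EuclideanSpace ℝ (Fin 3) => (∑ i, ‖ψ x i‖ ^ 2) / ‖x‖ := by
    have h (c d : Fin 4) := ((((hu c).mul (hu c)).add ((hw d).mul (hw d))).div_norm).integrable
    refine (((h 0 0).add (h 1 1)).add (h 2 2)).add (h 3 3) |>.congr (.of_forall fun x => ?_)
    simp only [sum_norm_sq_eq_realCoords, Fin.sum_univ_four, Pi.add_apply]
    ring
  have hR : Integrable fun x : EuclideanSpace ℝ (Fin 3) =>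
      (∑ i, ‖(diracKin ψ x + (m : ℂ) • diracBeta.mulVec (ψ x) - (a : ℂ) • ψ x) i‖ ^ 2)
        * ‖x‖ := by
    have hpd (j : Fin 3) : Continuous (pd j ψ) :=
      (hs.continuous_fderiv (by simp)).clm_apply continuous_const
    refine Continuous.integrable_of_hasCompactSupport ?_ ?_
    · have := hs.continuous
      unfold diracKin
      fun_prop
    · refine HasCompactSupport.intro hc fun x hx => ?_
      have h1 : ψ x = 0 := image_eq_zero_of_notMem_tsupport hx
      have h2 (j : Fin 3) : pd j ψ x = 0 := image_eq_zero_of_notMem_tsupport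
        fun h => hx (tsupport_fderiv_apply_subset ℝ _ h)
      simp [diracKin, h1, h2]
  calc _ = ∫ x : EuclideanSpace ℝ (Fin 3),
        G x + (m ^ 2 - a ^ 2) / m ^ 2 * ((∑ i, ‖ψ x i‖ ^ 2) / ‖x‖) := by
        rw [integral_add hG.1 (hL.const_mul _), hG.2, zero_add, integral_const_mul]
    _ ≤ _ := integral_mono (hG.1.add (hL.const_mul _)) hR hle
end
end

section
/- Let m > 0, a ∈ (−m, m). For every ψ ∈ C_c^∞(ℝ³ \ {0})⁴, ((m²−a²)/m²) ∫_{ℝ³} |(1 + 2S·L)ψ|²/|x| dx ≤ ∫_{ℝ³} |(−i α·∇ + mβ − a)ψ|² |x| dx. -/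
open Matrix MeasureTheory

noncomputable section

section WeightedIntegration

variable {F : Type*} [NormedAddCommGroup F] [NormedSpace ℝ F]
  {s : Set (EuclideanSpace ℝ (Fin 3))}

theorem eventuallyEq_zero_of_isClosed {G : Type*} [Zero G]
    {f : EuclideanSpace ℝ (Fin 3) → G} (hs : IsClosed s)
    (hf : ∀ x ∉ s, f x = 0) {x : EuclideanSpace ℝ (Fin 3)} (hx : x ∉ s) :
    f =ᶠ[nhds x] fun _ => 0 :=
  Filter.eventually_of_mem (hs.isOpen_compl.mem_nhds hx) hf

theorem fderiv_eq_zero_of_isClosed {f : EuclideanSpace ℝ (Fin 3) → F} (hs : IsClosed s)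
    (hf : ∀ x ∉ s, f x = 0) : ∀ x ∉ s, fderiv ℝ f x = 0 := by
  intro x hx
  rw [(eventuallyEq_zero_of_isClosed hs hf hx).fderiv_eq]
  simp

theorem integrable_of_continuousOn_of_eq_zero {f : EuclideanSpace ℝ (Fin 3) → ℝ}
    (hs : IsCompact s) (hf : ContinuousOn f s) (hf0 : ∀ x ∉ s, f x = 0) : Integrable f :=
  (integrableOn_iff_integrable_of_support_subset
    (Function.support_subset_iff'.2 hf0)).1 (hf.integrableOn_compact hs)

theorem integrable_div_norm {f : EuclideanSpace ℝ (Fin 3) → ℝ} (hs : IsCompact s) (h0 : 0 ∉ s)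
    (hf : Continuous f) (hf0 : ∀ x ∉ s, f x = 0) : Integrable fun x => f x / ‖x‖ := by
  refine integrable_of_continuousOn_of_eq_zero hs ?_ fun x hx => by simp [hf0 x hx]
  refine hf.continuousOn.div continuous_norm.continuousOn fun x hx => ?_
  exact norm_ne_zero_iff.2 fun h => h0 (h ▸ hx)

theorem contDiff_div_norm {f : EuclideanSpace ℝ (Fin 3) → ℝ} (hs : IsClosed s) (h0 : 0 ∉ s)
    (hf : ContDiff ℝ 1 f) (hf0 : ∀ x ∉ s, f x = 0) : ContDiff ℝ 1 fun x => f x / ‖x‖ := by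
  rw [contDiff_iff_contDiffAt]
  intro x
  by_cases hx : x ∈ s
  · have hx0 : x ≠ 0 := fun h => h0 (h ▸ hx)
    exact hf.contDiffAt.div (contDiffAt_norm ℝ hx0) (norm_ne_zero_iff.2 hx0)
  · exact contDiffAt_const.congr_of_eventuallyEq
      (eventuallyEq_zero_of_isClosed (f := fun x => f x / ‖x‖) hs
        (fun y hy => by simp [hf0 y hy]) hx)

/-- Integrating the derivative of a compactly supported function along a linear vector field. -/
theorem integral_fderiv_apply_clm {g : EuclideanSpace ℝ (Fin 3) → ℝ} (hs : IsCompact s)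
    (hg : ContDiff ℝ 1 g) (hg0 : ∀ x ∉ s, g x = 0)
    (A : EuclideanSpace ℝ (Fin 3) →L[ℝ] EuclideanSpace ℝ (Fin 3)) :
    ∫ x, fderiv ℝ g x (A x) = -(∑ j, A (EuclideanSpace.single j 1) j) * ∫ x, g x := by
  have hg' : Continuous (fderiv ℝ g) := hg.continuous_fderiv (by norm_num)
  have hg'0 := fderiv_eq_zero_of_isClosed hs.isClosed hg0
  have hgc := hg.continuous
  have expand : ∀ x, fderiv ℝ g x (A x)
      = ∑ j, A x j * fderiv ℝ g x (EuclideanSpace.single j 1) := by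
    intro x
    conv_lhs => rw [← (EuclideanSpace.basisFun (Fin 3) ℝ).sum_repr (A x)]
    simp
  have coord : ∀ (j : Fin 3) (x v : EuclideanSpace ℝ (Fin 3)),
      fderiv ℝ (fun y => A y j) x v = A v j := by
    intro j x v
    have : HasFDerivAt (fun y => A y j) ((EuclideanSpace.proj (𝕜 := ℝ) j).comp A) x :=
      ((EuclideanSpace.proj (𝕜 := ℝ) j).comp A).hasFDerivAt
    rw [this.fderiv]
    rfl
  have hint : ∀ j : Fin 3,
      Integrable fun x => A x j * fderiv ℝ g x (EuclideanSpace.single j 1) := by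
    intro j
    refine integrable_of_continuousOn_of_eq_zero hs (Continuous.continuousOn ?_)
      fun x hx => by simp [hg'0 x hx]
    fun_prop
  simp_rw [expand]
  rw [integral_finsetSum _ fun j _ => hint j, neg_mul, Finset.sum_mul, ← Finset.sum_neg_distrib]
  refine Finset.sum_congr rfl fun j _ => ?_
  rw [integral_mul_fderiv_eq_neg_fderiv_mul_of_integrable (f := fun x => A x j)]
  · simp_rw [coord]
    rw [integral_const_mul]
  · simp_rw [coord]
    exact (integrable_of_continuousOn_of_eq_zero hs hgc.continuousOn hg0).const_mul _
  · exact hint j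
  · refine integrable_of_continuousOn_of_eq_zero hs (Continuous.continuousOn ?_)
      fun x hx => by simp [hg0 x hx]
    fun_prop
  · intro x _
    exact ((EuclideanSpace.proj (𝕜 := ℝ) j).comp A).differentiableAt
  · intro x _
    exact hg.differentiable (by norm_num) x

theorem fderiv_div_norm_apply {f : EuclideanSpace ℝ (Fin 3) → ℝ} (hf : Differentiable ℝ f)
    {A : EuclideanSpace ℝ (Fin 3) →L[ℝ] EuclideanSpace ℝ (Fin 3)} {c : ℝ}
    (hA : ∀ x, inner ℝ x (A x) = c * ‖x‖ ^ 2) (x : EuclideanSpace ℝ (Fin 3)) :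
    fderiv ℝ (fun x => f x / ‖x‖) x (A x) = fderiv ℝ f x (A x) / ‖x‖ - c * (f x / ‖x‖) := by
  by_cases hx : x = 0
  · simp [hx]
  have hx' : ‖x‖ ≠ 0 := norm_ne_zero_iff.2 hx
  have hn : HasFDerivAt (fun y : EuclideanSpace ℝ (Fin 3) => ‖y‖)
      (fderiv ℝ (fun y : EuclideanSpace ℝ (Fin 3) => ‖y‖) x) x :=
    ((contDiffAt_norm (n := 1) ℝ hx).differentiableAt (by norm_num)).hasFDerivAt
  have hnv : fderiv ℝ (fun y : EuclideanSpace ℝ (Fin 3) => ‖y‖) x (A x) = c * ‖x‖ := by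
    refine mul_left_cancel₀ hx' ?_
    have h1 := (hasStrictFDerivAt_norm_sq x).hasFDerivAt.unique (hn.pow 2)
    have h2 := congrArg (fun L => L (A x)) h1
    simp at h2
    rw [hA] at h2
    linarith
  have hd := (hf x).hasFDerivAt.fun_mul ((hasDerivAt_inv hx').comp_hasFDerivAt x hn)
  simp only [Function.comp_apply] at hd
  simp_rw [div_eq_mul_inv]
  rw [hd.fderiv]
  simp
  field_simp
  linear_combination (-f x) * hnv

theorem integral_fderiv_apply_clm_div_norm {f : EuclideanSpace ℝ (Fin 3) → ℝ}
    (hs : IsCompact s) (h0 : 0 ∉ s) (hf : ContDiff ℝ 1 f) (hf0 : ∀ x ∉ s, f x = 0)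
    {A : EuclideanSpace ℝ (Fin 3) →L[ℝ] EuclideanSpace ℝ (Fin 3)} {c : ℝ}
    (hA : ∀ x, inner ℝ x (A x) = c * ‖x‖ ^ 2) :
    ∫ x, fderiv ℝ f x (A x) / ‖x‖ = -(2 * c) * ∫ x, f x / ‖x‖ := by
  have hf' : Continuous (fderiv ℝ f) := hf.continuous_fderiv (by norm_num)
  have key := integral_fderiv_apply_clm hs (contDiff_div_norm hs.isClosed h0 hf hf0)
    (fun x hx => by simp [hf0 x hx]) A
  have htr : ∑ j, A (EuclideanSpace.single j 1) j = 3 * c := by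
    have : ∀ j, A (EuclideanSpace.single j 1) j = c := fun j => by
      simpa [EuclideanSpace.inner_single_left] using hA (EuclideanSpace.single j 1)
    simp [this]
  simp_rw [fderiv_div_norm_apply (hf.differentiable (by norm_num)) hA] at key
  rw [htr, integral_sub, integral_const_mul] at key
  · linarith
  · refine integrable_div_norm hs h0 (by fun_prop) fun x hx => ?_
    simp [fderiv_eq_zero_of_isClosed hs.isClosed hf0 x hx]
  · exact (integrable_div_norm hs h0 hf.continuous hf0).const_mul _

/-- For an antisymmetric form `B`, the Euler field and a commuting rotation field pair to zero
after the shift by the zeroth order term, with respect to the weight `‖x‖⁻¹`. -/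
theorem integral_antisymm_fderiv_div_norm {ψ : EuclideanSpace ℝ (Fin 3) → F} (hs : IsCompact s)
    (h0 : 0 ∉ s) (hψ : ContDiff ℝ 2 ψ) (hψ0 : ∀ x ∉ s, ψ x = 0)
    {B : F →L[ℝ] F →L[ℝ] ℝ} (hB : ∀ u v, B u v = -B v u)
    {A : EuclideanSpace ℝ (Fin 3) →L[ℝ] EuclideanSpace ℝ (Fin 3)}
    (hA : ∀ x, inner ℝ x (A x) = 0) :
    ∫ x, B (fderiv ℝ ψ x x + ψ x) (fderiv ℝ ψ x (A x)) / ‖x‖ = 0 := by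
  have hψ' : ContDiff ℝ 1 (fderiv ℝ ψ) := hψ.fderiv_right (by norm_num)
  have hψ1 : ContDiff ℝ 1 ψ := hψ.of_le (by norm_num)
  have deriv_eq : ∀ (L : EuclideanSpace ℝ (Fin 3) →L[ℝ] EuclideanSpace ℝ (Fin 3))
      (x v : EuclideanSpace ℝ (Fin 3)),
      fderiv ℝ (fun y => B (ψ y) (fderiv ℝ ψ y (L y))) x v
        = B (fderiv ℝ ψ x v) (fderiv ℝ ψ x (L x))
          + B (ψ x) (fderiv ℝ (fderiv ℝ ψ) x v (L x) + fderiv ℝ ψ x (L v)) := by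
    intro L x v
    have h1 := (hψ1.differentiable (by norm_num) x).hasFDerivAt
    have h2 := ((hψ'.differentiable (by norm_num) x).hasFDerivAt).clm_apply (L.hasFDerivAt (x := x))
    rw [(B.hasFDerivAt_of_bilinear h1 h2).fderiv]
    simp
    ring
  have smooth : ∀ L : EuclideanSpace ℝ (Fin 3) →L[ℝ] EuclideanSpace ℝ (Fin 3),
      ContDiff ℝ 1 fun y => B (ψ y) (fderiv ℝ ψ y (L y)) := fun L => by fun_prop
  have van : ∀ L : EuclideanSpace ℝ (Fin 3) →L[ℝ] EuclideanSpace ℝ (Fin 3),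
      ∀ x ∉ s, B (ψ x) (fderiv ℝ ψ x (L x)) = 0 := fun L x hx => by simp [hψ0 x hx]
  have e1 := integral_fderiv_apply_clm_div_norm hs h0 (smooth A) (van A)
    (A := ContinuousLinearMap.id ℝ _) (c := 1) (fun x => by simp)
  have e2 := integral_fderiv_apply_clm_div_norm hs h0 (smooth (ContinuousLinearMap.id ℝ _))
    (van _) (A := A) (c := 0) (fun x => by simp [hA])
  have i1 := integrable_div_norm hs h0 (smooth A).continuous (van A)
  have i2 : Integrable fun x => fderiv ℝ (fun y => B (ψ y) (fderiv ℝ ψ y (A y))) x x / ‖x‖ := by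
    have := (smooth A).continuous_fderiv (by norm_num)
    refine integrable_div_norm hs h0 (by fun_prop) fun x hx => ?_
    simp [fderiv_eq_zero_of_isClosed hs.isClosed (van A) x hx]
  have i3 : Integrable fun x => fderiv ℝ (fun y => B (ψ y) (fderiv ℝ ψ y y)) x (A x) / ‖x‖ := by
    have := (smooth (ContinuousLinearMap.id ℝ _)).continuous_fderiv (by norm_num)
    refine integrable_div_norm hs h0 (by fun_prop) fun x hx => ?_
    exact DFunLike.congr_fun
      (fderiv_eq_zero_of_isClosed hs.isClosed (van (ContinuousLinearMap.id ℝ _)) x hx) (A x)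
  have pointwise : ∀ x, B (fderiv ℝ ψ x x + ψ x) (fderiv ℝ ψ x (A x)) / ‖x‖
      = 1 / 2 * (fderiv ℝ (fun y => B (ψ y) (fderiv ℝ ψ y (A y))) x x / ‖x‖
        - fderiv ℝ (fun y => B (ψ y) (fderiv ℝ ψ y y)) x (A x) / ‖x‖)
        + B (ψ x) (fderiv ℝ ψ x (A x)) / ‖x‖ := by
    intro x
    have hsymm := (hψ.contDiffAt (x := x)).isSymmSndFDerivAt (by simp) x (A x)
    have h2 := deriv_eq (ContinuousLinearMap.id ℝ _) x (A x)
    simp only [ContinuousLinearMap.id_apply] at h2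
    rw [deriv_eq, h2, hsymm, hB (fderiv ℝ ψ x (A x)) (fderiv ℝ ψ x x)]
    simp
    ring
  simp_rw [pointwise]
  simp only [ContinuousLinearMap.id_apply] at e1 e2
  rw [integral_add (Integrable.const_mul (by exact i2.sub i3) _) i1, integral_const_mul,
    integral_sub i2 i3, e1, e2]
  ring

/-- For a symmetric form `B`, the quadratic field `B ψ ψ` satisfies the weighted Euler identity. -/
theorem integral_symm_fderiv_div_norm {ψ : EuclideanSpace ℝ (Fin 3) → F} (hs : IsCompact s)
    (h0 : 0 ∉ s) (hψ : ContDiff ℝ 1 ψ) (hψ0 : ∀ x ∉ s, ψ x = 0)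
    {B : F →L[ℝ] F →L[ℝ] ℝ} (hB : ∀ u v, B u v = B v u) :
    ∫ x, B (fderiv ℝ ψ x x + ψ x) (ψ x) / ‖x‖ = 0 := by
  have smooth : ContDiff ℝ 1 fun y => B (ψ y) (ψ y) := by fun_prop
  have van : ∀ x ∉ s, B (ψ x) (ψ x) = 0 := fun x hx => by simp [hψ0 x hx]
  have e1 := integral_fderiv_apply_clm_div_norm hs h0 smooth van
    (A := ContinuousLinearMap.id ℝ _) (c := 1) (fun x => by simp)
  have i1 := integrable_div_norm hs h0 smooth.continuous van
  have i2 : Integrable fun x => fderiv ℝ (fun y => B (ψ y) (ψ y)) x x / ‖x‖ := by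
    have := smooth.continuous_fderiv (by norm_num)
    refine integrable_div_norm hs h0 (by fun_prop) fun x hx => ?_
    simp [fderiv_eq_zero_of_isClosed hs.isClosed van x hx]
  have pointwise : ∀ x, B (fderiv ℝ ψ x x + ψ x) (ψ x) / ‖x‖
      = 1 / 2 * (fderiv ℝ (fun y => B (ψ y) (ψ y)) x x / ‖x‖) + B (ψ x) (ψ x) / ‖x‖ := by
    intro x
    have h1 := (hψ.differentiable (by norm_num) x).hasFDerivAt
    rw [(B.hasFDerivAt_of_bilinear h1 h1).fderiv]
    simp [hB (ψ x) (fderiv ℝ ψ x x)]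
    ring
  simp_rw [pointwise]
  simp only [ContinuousLinearMap.id_apply] at e1
  rw [integral_add (i2.const_mul _) i1, integral_const_mul, e1]
  ring

/-- Integration by parts of `x_k` times a rotation field applied to the quadratic field `B ψ ψ`. -/
theorem integral_coord_mul_symm_fderiv_div_norm {ψ : EuclideanSpace ℝ (Fin 3) → F}
    (hs : IsCompact s) (h0 : 0 ∉ s) (hψ : ContDiff ℝ 1 ψ) (hψ0 : ∀ x ∉ s, ψ x = 0)
    {B : F →L[ℝ] F →L[ℝ] ℝ} (hB : ∀ u v, B u v = B v u)
    {A : EuclideanSpace ℝ (Fin 3) →L[ℝ] EuclideanSpace ℝ (Fin 3)}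
    (hA : ∀ x, inner ℝ x (A x) = 0) (k : Fin 3) :
    ∫ x, (2 * x k * B (ψ x) (fderiv ℝ ψ x (A x)) + A x k * B (ψ x) (ψ x)) / ‖x‖ = 0 := by
  have smooth : ContDiff ℝ 1 fun y : EuclideanSpace ℝ (Fin 3) => y k * B (ψ y) (ψ y) := by
    fun_prop
  have van : ∀ x ∉ s, x k * B (ψ x) (ψ x) = 0 := fun x hx => by simp [hψ0 x hx]
  have e1 := integral_fderiv_apply_clm_div_norm hs h0 smooth van
    (A := A) (c := 0) (fun x => by simp [hA])
  simp only [mul_zero, neg_zero, zero_mul] at e1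
  rw [← e1]
  congr 1 with x
  have h1 := (hψ.differentiable (by norm_num) x).hasFDerivAt
  have hk : HasFDerivAt (fun y : EuclideanSpace ℝ (Fin 3) => y k)
    (EuclideanSpace.proj (𝕜 := ℝ) k) x := (EuclideanSpace.proj (𝕜 := ℝ) k).hasFDerivAt
  rw [(hk.fun_mul (B.hasFDerivAt_of_bilinear h1 h1)).fderiv]
  simp [hB (fderiv ℝ ψ x (A x)) (ψ x)]
  ring

end WeightedIntegration

section SpinorAlgebra

/-- The real part of the sesquilinear form `⟨u, M v⟩` on 4-spinors. -/
def spinorForm (M : Matrix (Fin 2 ⊕ Fin 2) (Fin 2 ⊕ Fin 2) ℂ) :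
    (Fin 2 ⊕ Fin 2 → ℂ) →L[ℝ] (Fin 2 ⊕ Fin 2 → ℂ) →L[ℝ] ℝ :=
  LinearMap.toContinuousBilinearMap <|
    LinearMap.mk₂ ℝ (fun u v => (star u ⬝ᵥ M *ᵥ v).re)
      (by intros; simp [add_dotProduct])
      (by intros; simp)
      (by intros; simp [mulVec_add])
      (by intros; simp [mulVec_smul])

theorem spinorForm_apply (M : Matrix (Fin 2 ⊕ Fin 2) (Fin 2 ⊕ Fin 2) ℂ)
    (u v : Fin 2 ⊕ Fin 2 → ℂ) : spinorForm M u v = (star u ⬝ᵥ M *ᵥ v).re := rfl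

theorem spinorForm_mulVec (M N : Matrix (Fin 2 ⊕ Fin 2) (Fin 2 ⊕ Fin 2) ℂ)
    (u v : Fin 2 ⊕ Fin 2 → ℂ) : spinorForm M u (N *ᵥ v) = spinorForm (M * N) u v := by
  simp [spinorForm_apply]

theorem spinorForm_conjTranspose (M : Matrix (Fin 2 ⊕ Fin 2) (Fin 2 ⊕ Fin 2) ℂ)
    (u v : Fin 2 ⊕ Fin 2 → ℂ) : spinorForm Mᴴ u v = spinorForm M v u := by
  rw [spinorForm_apply, spinorForm_apply, ← Complex.conj_re (star v ⬝ᵥ M *ᵥ u),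
    starRingEnd_apply, star_dotProduct u, star_mulVec, conjTranspose_conjTranspose,
    ← dotProduct_mulVec]

theorem spinorForm_comm {M : Matrix (Fin 2 ⊕ Fin 2) (Fin 2 ⊕ Fin 2) ℂ} (hM : Mᴴ = M)
    (u v : Fin 2 ⊕ Fin 2 → ℂ) : spinorForm M u v = spinorForm M v u := by
  rw [← spinorForm_conjTranspose, hM]

theorem spinorForm_anticomm {M : Matrix (Fin 2 ⊕ Fin 2) (Fin 2 ⊕ Fin 2) ℂ} (hM : Mᴴ = -M)
    (u v : Fin 2 ⊕ Fin 2 → ℂ) : spinorForm M u v = -spinorForm M v u := by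
  rw [← spinorForm_conjTranspose, hM]
  simp [spinorForm_apply, neg_mulVec]

/-- The weight `1 - t β`. -/
def betaWeight (t : ℝ) : Matrix (Fin 2 ⊕ Fin 2) (Fin 2 ⊕ Fin 2) ℂ := 1 - (t : ℂ) • diracBeta

theorem betaWeight_conjTranspose (t : ℝ) : (betaWeight t)ᴴ = betaWeight t := by
  simp [betaWeight, diracBeta, fromBlocks_conjTranspose]

theorem Pauli_conjTranspose (j : Fin 3) : (Pauli j)ᴴ = Pauli j := by
  ext i k
  fin_cases j <;> fin_cases i <;> fin_cases k <;> simp [Pauli]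

theorem spinS_conjTranspose (j : Fin 3) : (spinS j)ᴴ = spinS j := by
  simp [spinS, fromBlocks_conjTranspose, Pauli_conjTranspose]

theorem betaWeight_mul_spinS_comm (t : ℝ) (j : Fin 3) :
    betaWeight t * spinS j = spinS j * betaWeight t := by
  simp [betaWeight, spinS, diracBeta, sub_mul, mul_sub, fromBlocks_multiply]

theorem betaWeight_mul_spin_antihermitian (t : ℝ) (j : Fin 3) :
    (betaWeight t * (-(2 * Complex.I)) • spinS j)ᴴ
      = -(betaWeight t * (-(2 * Complex.I)) • spinS j) := by
  rw [conjTranspose_mul, conjTranspose_smul, spinS_conjTranspose, betaWeight_conjTranspose,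
    Matrix.mul_smul, Matrix.smul_mul, betaWeight_mul_spinS_comm, ← neg_smul]
  simp

theorem I_smul_beta_mul_alpha_conjTranspose (l : Fin 3) :
    (Complex.I • (diracBeta * diracAlpha l))ᴴ = Complex.I • (diracBeta * diracAlpha l) := by
  simp [diracBeta, diracAlpha, fromBlocks_conjTranspose, fromBlocks_multiply, fromBlocks_smul,
    Pauli_conjTranspose]

/-- The rotation field around the `j`-th axis. -/
def rotField (j : Fin 3) : EuclideanSpace ℝ (Fin 3) →L[ℝ] EuclideanSpace ℝ (Fin 3) :=
  (EuclideanSpace.proj (𝕜 := ℝ) (j + 1)).smulRight (EuclideanSpace.single (j + 2) 1)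
    - (EuclideanSpace.proj (𝕜 := ℝ) (j + 2)).smulRight (EuclideanSpace.single (j + 1) 1)

theorem rotField_apply (j : Fin 3) (x : EuclideanSpace ℝ (Fin 3)) :
    rotField j x = x (j + 1) • EuclideanSpace.single (j + 2) 1
      - x (j + 2) • EuclideanSpace.single (j + 1) 1 := rfl

theorem inner_rotField (j : Fin 3) (x : EuclideanSpace ℝ (Fin 3)) :
    inner ℝ x (rotField j x) = 0 := by
  rw [rotField_apply, inner_sub_right, inner_smul_right, inner_smul_right]
  simp [EuclideanSpace.inner_single_right]
  ring

theorem fderiv_rotField (j : Fin 3) (ψ : EuclideanSpace ℝ (Fin 3) → (Fin 2 ⊕ Fin 2) → ℂ)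
    (x : EuclideanSpace ℝ (Fin 3)) :
    fderiv ℝ ψ x (rotField j x) = ((x (j + 1) : ℝ) : ℂ) • pd (j + 2) ψ x
      - ((x (j + 2) : ℝ) : ℂ) • pd (j + 1) ψ x := by
  rw [rotField_apply, map_sub, map_smul, map_smul]
  rfl

theorem angL_eq (j : Fin 3) (ψ : EuclideanSpace ℝ (Fin 3) → (Fin 2 ⊕ Fin 2) → ℂ)
    (x : EuclideanSpace ℝ (Fin 3)) : angL j ψ x = (-Complex.I) • fderiv ℝ ψ x (rotField j x) := by
  rw [angL, fderiv_rotField]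

theorem opK_eq (ψ : EuclideanSpace ℝ (Fin 3) → (Fin 2 ⊕ Fin 2) → ℂ)
    (x : EuclideanSpace ℝ (Fin 3)) :
    opK ψ x = ψ x + ∑ j, ((-(2 * Complex.I)) • spinS j) *ᵥ fderiv ℝ ψ x (rotField j x) := by
  simp only [opK, angL_eq, Finset.smul_sum]
  congr 1
  refine Finset.sum_congr rfl fun j _ => ?_
  rw [mulVec_smul, smul_mulVec, smul_smul]
  ring_nf

theorem fderiv_self_eq (ψ : EuclideanSpace ℝ (Fin 3) → (Fin 2 ⊕ Fin 2) → ℂ)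
    (x : EuclideanSpace ℝ (Fin 3)) : fderiv ℝ ψ x x = ∑ j, (x j : ℂ) • pd j ψ x := by
  have h := congrArg (fderiv ℝ ψ x) ((EuclideanSpace.basisFun (Fin 3) ℝ).sum_repr x)
  rw [← h, map_sum]
  refine Finset.sum_congr rfl fun j _ => ?_
  simp [pd]

/-- The matrix `α·x`. -/
def alphaDot (x : EuclideanSpace ℝ (Fin 3)) : Matrix (Fin 2 ⊕ Fin 2) (Fin 2 ⊕ Fin 2) ℂ :=
  ∑ j, (x j : ℂ) • diracAlpha j

theorem norm_sq_alphaDot_mulVec (x : EuclideanSpace ℝ (Fin 3)) (v : Fin 2 ⊕ Fin 2 → ℂ) :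
    ∑ i, ‖(alphaDot x *ᵥ v) i‖ ^ 2 = ‖x‖ ^ 2 * ∑ i, ‖v i‖ ^ 2 := by
  rw [EuclideanSpace.real_norm_sq_eq]
  simp only [Complex.sq_norm, Complex.normSq_apply]
  simp [alphaDot, diracAlpha, Pauli, Fin.sum_univ_three, mulVec, dotProduct]
  ring

theorem alphaDot_mulVec_diracKin (ψ : EuclideanSpace ℝ (Fin 3) → (Fin 2 ⊕ Fin 2) → ℂ)
    (x : EuclideanSpace ℝ (Fin 3)) :
    Complex.I • alphaDot x *ᵥ diracKin ψ x = fderiv ℝ ψ x x + ψ x - opK ψ x := by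
  rw [fderiv_self_eq]
  ext i
  rcases i with i | i <;> fin_cases i <;>
  simp [alphaDot, diracKin, opK, angL, spinS, diracAlpha, Pauli, Fin.sum_univ_three, mulVec,
    dotProduct] <;>
  ring_nf <;> simp <;> ring_nf

/-- The pairing of `i (α·x) β ψ` with `(1 + 2 S·L) ψ` is a combination of rotation fields applied
to quadratic fields. -/
theorem spinorForm_alphaDot_beta (ψ : EuclideanSpace ℝ (Fin 3) → (Fin 2 ⊕ Fin 2) → ℂ)
    (x : EuclideanSpace ℝ (Fin 3)) :
    spinorForm 1 (Complex.I • alphaDot x *ᵥ diracBeta *ᵥ ψ x) (opK ψ x)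
      = -(1 / 2) * ∑ l : Fin 3,
        ((2 * x (l + 1) * spinorForm (Complex.I • (diracBeta * diracAlpha l)) (ψ x)
              (fderiv ℝ ψ x (rotField (l + 2) x))
            + rotField (l + 2) x (l + 1)
              * spinorForm (Complex.I • (diracBeta * diracAlpha l)) (ψ x) (ψ x))
          - (2 * x (l + 2) * spinorForm (Complex.I • (diracBeta * diracAlpha l)) (ψ x)
              (fderiv ℝ ψ x (rotField (l + 1) x))
            + rotField (l + 1) x (l + 2)
              * spinorForm (Complex.I • (diracBeta * diracAlpha l)) (ψ x) (ψ x))) := by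
  simp only [opK, angL, fderiv_rotField, spinorForm_apply]
  simp only [rotField_apply, Fin.sum_univ_three, Fin.isValue, Fin.reduceAdd]
  generalize pd 0 ψ x = p
  generalize pd 1 ψ x = q
  generalize pd 2 ψ x = r
  generalize ψ x = u
  set_option maxRecDepth 4000 in
  simp [alphaDot, spinS, diracAlpha, diracBeta, Pauli, Fin.sum_univ_three, mulVec, dotProduct,
    fromBlocks_multiply, -mulVec_mulVec]
  ring

/-- Pointwise lower bound obtained by expanding a square in one component. -/
theorem square_expansion_nonneg {m a e : ℝ} (hm : 0 < m) (he : e ^ 2 = 1) (P k q : ℂ) :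
    0 ≤ ‖P - k + ((m + e * a : ℝ) : ℂ) * q‖ ^ 2 + 2 * ((1 - a / m * e) * (star P * k).re)
      + 2 * (m * ((m ^ 2 - a ^ 2) / m ^ 2) * (star q * k).re)
      - (m ^ 2 - a ^ 2) / m ^ 2 * ‖k‖ ^ 2 := by
  have h : 0 ≤ ‖P - k + ((m + e * a : ℝ) : ℂ) * q + ((1 - a / m * e : ℝ) : ℂ) * k‖ ^ 2 := by
    positivity
  refine h.trans_eq ?_
  simp only [Complex.sq_norm, Complex.normSq_apply]
  simp
  field_simp
  grind

theorem dirac_square_nonneg {m : ℝ} (hm : 0 < m) (a : ℝ)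
    (ψ : EuclideanSpace ℝ (Fin 3) → (Fin 2 ⊕ Fin 2) → ℂ) (x : EuclideanSpace ℝ (Fin 3)) :
    0 ≤ ‖x‖ ^ 2 *
        (∑ i, ‖(diracKin ψ x + (m : ℂ) • diracBeta.mulVec (ψ x) - (a : ℂ) • ψ x) i‖ ^ 2)
      + 2 * spinorForm (betaWeight (a / m)) (fderiv ℝ ψ x x + ψ x) (opK ψ x)
      + 2 * (m * ((m ^ 2 - a ^ 2) / m ^ 2)
        * spinorForm 1 (Complex.I • alphaDot x *ᵥ diracBeta *ᵥ ψ x) (opK ψ x))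
      - (m ^ 2 - a ^ 2) / m ^ 2 * ∑ i, ‖opK ψ x i‖ ^ 2 := by
  have hI : ∀ w : Fin 2 ⊕ Fin 2 → ℂ, ∑ i, ‖w i‖ ^ 2 = ∑ i, ‖(Complex.I • w) i‖ ^ 2 :=
    fun w => by simp
  have hH : Complex.I • alphaDot x *ᵥ
      (diracKin ψ x + (m : ℂ) • diracBeta.mulVec (ψ x) - (a : ℂ) • ψ x)
      = fderiv ℝ ψ x x + ψ x - opK ψ x
        + ((m : ℂ) • (Complex.I • alphaDot x *ᵥ diracBeta *ᵥ ψ x)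
          + (a : ℂ) • (diracBeta *ᵥ (Complex.I • alphaDot x *ᵥ diracBeta *ᵥ ψ x))) := by
    rw [mulVec_sub, mulVec_add, smul_sub, smul_add, alphaDot_mulVec_diracKin]
    have : diracBeta * (alphaDot x * diracBeta) = -alphaDot x := by
      simp [alphaDot, diracAlpha, diracBeta, Finset.sum_mul, Finset.mul_sum, fromBlocks_multiply,
        fromBlocks_neg, ← Finset.sum_neg_distrib, ← smul_neg]
    simp only [mulVec_smul, mulVec_mulVec, this, neg_mulVec, smul_neg]
    rw [smul_comm Complex.I, smul_comm Complex.I]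
    abel
  rw [← norm_sq_alphaDot_mulVec, hI (alphaDot x *ᵥ _), hH]
  generalize fderiv ℝ ψ x x + ψ x = P
  generalize opK ψ x = k
  generalize Complex.I • alphaDot x *ᵥ diracBeta *ᵥ ψ x = q
  have hl := fun i : Fin 2 => square_expansion_nonneg (a := a) hm (e := 1) (by norm_num)
    (P (Sum.inl i)) (k (Sum.inl i)) (q (Sum.inl i))
  have hr := fun i : Fin 2 => square_expansion_nonneg (a := a) hm (e := -1) (by norm_num)
    (P (Sum.inr i)) (k (Sum.inr i)) (q (Sum.inr i))
  refine (add_nonneg (add_nonneg (hl 0) (hl 1)) (add_nonneg (hr 0) (hr 1))).trans_eq ?_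
  simp [spinorForm_apply, betaWeight, diracBeta, mulVec, dotProduct, Matrix.sub_apply]
  ring_nf

end SpinorAlgebra

section DiracIntegrals

variable {ψ : EuclideanSpace ℝ (Fin 3) → (Fin 2 ⊕ Fin 2) → ℂ} {s : Set (EuclideanSpace ℝ (Fin 3))}

theorem continuous_pd (hψ : ContDiff ℝ 1 ψ) (j : Fin 3) : Continuous (pd j ψ) := by
  have := hψ.continuous_fderiv (by norm_num)
  unfold pd
  fun_prop

theorem continuous_opK (hψ : ContDiff ℝ 1 ψ) : Continuous (opK ψ) := by
  have := hψ.continuous_fderiv (by norm_num)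
  simp_rw [funext (opK_eq ψ)]
  refine hψ.continuous.add (continuous_finsetSum _ fun j _ => ?_)
  exact continuous_const.matrix_mulVec (by fun_prop)

theorem opK_eq_zero (hs : IsClosed s) (hψ0 : ∀ x ∉ s, ψ x = 0) : ∀ x ∉ s, opK ψ x = 0 := by
  intro x hx
  simp [opK_eq, hψ0 x hx, fderiv_eq_zero_of_isClosed hs hψ0 x hx]

theorem continuous_diracKin (hψ : ContDiff ℝ 1 ψ) : Continuous (diracKin ψ) := by
  have h : Continuous fun x => ∑ j, diracAlpha j *ᵥ pd j ψ x :=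
    continuous_finsetSum _ fun j _ => continuous_const.matrix_mulVec (continuous_pd hψ j)
  exact h.const_smul (-Complex.I)

theorem diracKin_eq_zero (hs : IsClosed s) (hψ0 : ∀ x ∉ s, ψ x = 0) :
    ∀ x ∉ s, diracKin ψ x = 0 := by
  intro x hx
  simp [diracKin, pd, fderiv_eq_zero_of_isClosed hs hψ0 x hx]

/-- The radial derivative is orthogonal to the weighted spin-orbit operator. -/
theorem integral_spinorForm_radial (hs : IsCompact s) (h0 : 0 ∉ s) (hψ : ContDiff ℝ 2 ψ)
    (hψ0 : ∀ x ∉ s, ψ x = 0) (t : ℝ) :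
    ∫ x, spinorForm (betaWeight t) (fderiv ℝ ψ x x + ψ x) (opK ψ x) / ‖x‖ = 0 := by
  have hψ1 : ContDiff ℝ 1 ψ := hψ.of_le (by norm_num)
  have hc := hψ.continuous
  have hc' := hψ1.continuous_fderiv (by norm_num)
  have split : ∀ x, spinorForm (betaWeight t) (fderiv ℝ ψ x x + ψ x) (opK ψ x) / ‖x‖
      = spinorForm (betaWeight t) (fderiv ℝ ψ x x + ψ x) (ψ x) / ‖x‖
        + ∑ j, spinorForm (betaWeight t * (-(2 * Complex.I)) • spinS j) (fderiv ℝ ψ x x + ψ x)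
          (fderiv ℝ ψ x (rotField j x)) / ‖x‖ := by
    intro x
    rw [opK_eq, map_add (spinorForm _ _), map_sum, add_div, Finset.sum_div]
    simp_rw [spinorForm_mulVec]
  simp_rw [split]
  rw [integral_add, integral_finsetSum]
  · rw [integral_symm_fderiv_div_norm hs h0 hψ1 hψ0
      (spinorForm_comm (betaWeight_conjTranspose t)), zero_add]
    exact Finset.sum_eq_zero fun j _ => integral_antisymm_fderiv_div_norm hs h0 hψ hψ0
      (spinorForm_anticomm (betaWeight_mul_spin_antihermitian t j)) (inner_rotField j)
  · exact fun j _ => integrable_div_norm hs h0 (by fun_prop) fun x hx => by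
      simp [fderiv_eq_zero_of_isClosed hs.isClosed hψ0 x hx]
  · exact integrable_div_norm hs h0 (by fun_prop) fun x hx => by simp [hψ0 x hx]
  · exact integrable_finsetSum _ fun j _ => integrable_div_norm hs h0 (by fun_prop) fun x hx => by
      simp [fderiv_eq_zero_of_isClosed hs.isClosed hψ0 x hx]

/-- The operator `i (α·x) β (1 + 2 S·L)` is antisymmetric with respect to the weight `‖x‖⁻¹`. -/
theorem integral_spinorForm_alphaDot_beta (hs : IsCompact s) (h0 : 0 ∉ s) (hψ : ContDiff ℝ 1 ψ)
    (hψ0 : ∀ x ∉ s, ψ x = 0) :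
    ∫ x, spinorForm 1 (Complex.I • alphaDot x *ᵥ diracBeta *ᵥ ψ x) (opK ψ x) / ‖x‖ = 0 := by
  have hc := hψ.continuous
  have hc' := hψ.continuous_fderiv (by norm_num)
  have hint : ∀ l j k : Fin 3, Integrable fun x : EuclideanSpace ℝ (Fin 3) =>
      (2 * x k * spinorForm (Complex.I • (diracBeta * diracAlpha l)) (ψ x)
          (fderiv ℝ ψ x (rotField j x))
        + rotField j x k * spinorForm (Complex.I • (diracBeta * diracAlpha l)) (ψ x) (ψ x))
        / ‖x‖ := fun l j k =>
    integrable_div_norm hs h0 (by fun_prop) fun x hx => by simp [hψ0 x hx]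
  have hzero := fun l j k : Fin 3 => integral_coord_mul_symm_fderiv_div_norm hs h0 hψ hψ0
      (spinorForm_comm (I_smul_beta_mul_alpha_conjTranspose l)) (inner_rotField j) k
  simp_rw [spinorForm_alphaDot_beta, mul_div_assoc, Finset.sum_div, sub_div]
  rw [integral_const_mul, integral_finsetSum]
  · rw [Finset.sum_eq_zero, mul_zero]
    intro l _
    rw [integral_sub (hint l _ _) (hint l _ _), hzero, hzero, sub_zero]
  · exact fun l _ => (hint l _ _).sub (hint l _ _)

end DiracIntegrals

/-- **Hardy-type inequality for the Dirac operator (strong form).** For `m > 0`,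
`a ∈ (-m, m)` and `ψ ∈ C_c^∞(ℝ³ \ {0})⁴`,
`((m²-a²)/m²) ∫ |(1+2S·L)ψ|²/|x| ≤ ∫ |(-i α·∇ + mβ - a)ψ|² |x|`. -/
theorem stmt_14 (m a : ℝ) (hm : 0 < m) (ha : a ∈ Set.Ioo (-m) m)
    (ψ : EuclideanSpace ℝ (Fin 3) → (Fin 2 ⊕ Fin 2) → ℂ)
    (hs : ContDiff ℝ (⊤ : ℕ∞) ψ) (hc : HasCompactSupport ψ) (h0 : 0 ∉ tsupport ψ) :
    ((m ^ 2 - a ^ 2) / m ^ 2) *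
        ∫ x : EuclideanSpace ℝ (Fin 3), (∑ i, ‖opK ψ x i‖ ^ 2) / ‖x‖
      ≤ ∫ x : EuclideanSpace ℝ (Fin 3),
          (∑ i, ‖(diracKin ψ x + (m : ℂ) • diracBeta.mulVec (ψ x) - (a : ℂ) • ψ x) i‖ ^ 2)
            * ‖x‖ := by
  have hK : IsCompact (tsupport ψ) := hc
  have hψ2 : ContDiff ℝ 2 ψ := contDiff_infty.1 hs 2
  have hψ1 : ContDiff ℝ 1 ψ := hψ2.of_le (by norm_num)
  have hψ0 : ∀ x ∉ tsupport ψ, ψ x = 0 := fun x hx => image_eq_zero_of_notMem_tsupport hx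
  have hc0 := hψ1.continuous
  have hc1 := hψ1.continuous_fderiv (by norm_num)
  have hcK := continuous_opK hψ1
  have hcD := continuous_diracKin hψ1
  have hcβ : Continuous fun x => diracBeta *ᵥ ψ x := continuous_const.matrix_mulVec hc0
  have hcα : Continuous fun x => alphaDot x *ᵥ diracBeta *ᵥ ψ x := by
    refine Continuous.matrix_mulVec ?_ hcβ
    unfold alphaDot
    fun_prop
  have zK := opK_eq_zero hK.isClosed hψ0
  have zD := diracKin_eq_zero hK.isClosed hψ0
  have iH : Integrable fun x : EuclideanSpace ℝ (Fin 3) => ‖x‖ ^ 2 * (∑ i, ‖(diracKin ψ x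
      + (m : ℂ) • diracBeta.mulVec (ψ x) - (a : ℂ) • ψ x) i‖ ^ 2) / ‖x‖ :=
    integrable_div_norm hK h0 (by fun_prop) fun x hx => by simp [zD x hx, hψ0 x hx]
  have iR : Integrable fun x => spinorForm (betaWeight (a / m)) (fderiv ℝ ψ x x + ψ x)
      (opK ψ x) / ‖x‖ :=
    integrable_div_norm hK h0 (by fun_prop) fun x hx => by simp [zK x hx]
  have iA : Integrable fun x => spinorForm 1 (Complex.I • alphaDot x *ᵥ diracBeta *ᵥ ψ x)
      (opK ψ x) / ‖x‖ :=
    integrable_div_norm hK h0 (by fun_prop) fun x hx => by simp [zK x hx]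
  have iK : Integrable fun x => (∑ i, ‖opK ψ x i‖ ^ 2) / ‖x‖ :=
    integrable_div_norm hK h0 (by fun_prop) fun x hx => by simp [zK x hx]
  have hmul : ∀ (x : EuclideanSpace ℝ (Fin 3)) (c : ℝ), c * ‖x‖ = ‖x‖ ^ 2 * c / ‖x‖ := by
    intro x c
    by_cases hx : ‖x‖ = 0
    · simp [hx]
    · field_simp
  simp_rw [hmul]
  have key : 0 ≤ ∫ x, (((‖x‖ ^ 2 * (∑ i, ‖(diracKin ψ x
      + (m : ℂ) • diracBeta.mulVec (ψ x) - (a : ℂ) • ψ x) i‖ ^ 2) / ‖x‖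
      + 2 * (spinorForm (betaWeight (a / m)) (fderiv ℝ ψ x x + ψ x) (opK ψ x) / ‖x‖))
      + 2 * (m * ((m ^ 2 - a ^ 2) / m ^ 2)) *
        (spinorForm 1 (Complex.I • alphaDot x *ᵥ diracBeta *ᵥ ψ x) (opK ψ x) / ‖x‖))
      - (m ^ 2 - a ^ 2) / m ^ 2 * ((∑ i, ‖opK ψ x i‖ ^ 2) / ‖x‖)) :=
    integral_nonneg fun x =>
      (div_nonneg (dirac_square_nonneg hm a ψ x) (norm_nonneg x)).trans_eq (by ring)
  have iHR := iH.fun_add (iR.const_mul 2)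
  rw [integral_sub (iHR.fun_add (iA.const_mul _)) (iK.const_mul _),
    integral_add iHR (iA.const_mul _), integral_add iH (iR.const_mul _),
    integral_const_mul, integral_const_mul, integral_const_mul,
    integral_spinorForm_radial hK h0 hψ2 hψ0, integral_spinorForm_alphaDot_beta hK h0 hψ1 hψ0]
    at key
  linarith
end
end

section
/- Let m > 0 and a ∈ (−m, m). For ψ ∈ C_c^∞(ℝ³ \ {0})⁴, the cross-term identity holds: −2 Re ∫_{ℝ³} (−i α·∇ + mβ − a)ψ · conj( i α·x̂ (1 − (a/m)β)(1 + 2S·L)ψ ) dx = −2 Re ∫_{ℝ³} (1 + 2S·L)(ψ/|x|) · conj( (1 − (a/m)β)(1 + 2S·L)ψ ) dx. -/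
open Matrix MeasureTheory

noncomputable section

local notation "SpaceR3" => EuclideanSpace ℝ (Fin 3)

local notation "Spinor" => (Fin 2 ⊕ Fin 2) → ℂ

open scoped ContDiff

namespace DiracCrossTerm

/-- The Hermitian pairing of spinors, linear in the first argument. -/
def pairing (u v : Spinor) : ℂ := ∑ i, u i * (starRingEnd ℂ) (v i)

/-- The Hermitian pairing as a real-bilinear continuous map. -/
def pairingL : Spinor →L[ℝ] Spinor →L[ℝ] ℂ :=
  LinearMap.toContinuousBilinearMap <| LinearMap.mk₂ ℝ pairing
    (fun u u' v => by simp only [pairing, Pi.add_apply, add_mul, Finset.sum_add_distrib])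
    (fun c u v => by simp [pairing, mul_assoc])
    (fun u v v' => by
      simp only [pairing, Pi.add_apply, map_add, mul_add, Finset.sum_add_distrib])
    (fun c u v => by simp [pairing, mul_left_comm])

lemma pairingL_apply (u v : Spinor) : pairingL u v = pairing u v := rfl

lemma pairing_add_left (u u' v : Spinor) :
    pairing (u + u') v = pairing u v + pairing u' v := by
  simp only [← pairingL_apply, map_add, _root_.add_apply]

lemma pairing_sub_left (u u' v : Spinor) :
    pairing (u - u') v = pairing u v - pairing u' v := by
  simp only [← pairingL_apply, map_sub, _root_.sub_apply]

lemma pairing_add_right (u v v' : Spinor) :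
    pairing u (v + v') = pairing u v + pairing u v' := by
  simp only [← pairingL_apply, map_add]

lemma pairing_sub_right (u v v' : Spinor) :
    pairing u (v - v') = pairing u v - pairing u v' := by
  simp only [← pairingL_apply, map_sub]

lemma pairing_smul_left (c : ℂ) (u v : Spinor) : pairing (c • u) v = c * pairing u v := by
  simp only [pairing, Pi.smul_apply, smul_eq_mul, mul_assoc, Finset.mul_sum]

lemma pairing_smul_right (c : ℂ) (u v : Spinor) :
    pairing u (c • v) = (starRingEnd ℂ) c * pairing u v := by
  simp only [pairing, Pi.smul_apply, smul_eq_mul, map_mul, Finset.mul_sum, mul_left_comm]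

lemma pairing_sum_left {κ : Type*} (s : Finset κ) (u : κ → Spinor) (v : Spinor) :
    pairing (∑ j ∈ s, u j) v = ∑ j ∈ s, pairing (u j) v := by
  simp only [← pairingL_apply, map_sum, _root_.sum_apply]

lemma pairing_sum_right {κ : Type*} (s : Finset κ) (u : Spinor) (v : κ → Spinor) :
    pairing u (∑ j ∈ s, v j) = ∑ j ∈ s, pairing u (v j) := by
  simp only [← pairingL_apply, map_sum]

lemma conj_pairing (u v : Spinor) : (starRingEnd ℂ) (pairing u v) = pairing v u := by
  simp [pairing, mul_comm]

lemma pairing_eq_dotProduct (u v : Spinor) : pairing u v = u ⬝ᵥ star v := rfl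

lemma pairing_mulVec_left (M : Matrix (Fin 2 ⊕ Fin 2) (Fin 2 ⊕ Fin 2) ℂ) (u v : Spinor) :
    pairing (M *ᵥ u) v = pairing u (Mᴴ *ᵥ v) := by
  rw [pairing_eq_dotProduct, pairing_eq_dotProduct, star_mulVec, conjTranspose_conjTranspose,
    dotProduct_comm, dotProduct_mulVec, dotProduct_comm]

/-- Smooth compactly supported spinor fields. -/
structure IsTest (u : SpaceR3 → Spinor) : Prop where
  smooth : ContDiff ℝ ∞ u
  compact : HasCompactSupport u

lemma contDiff_coord (l : Fin 3) : ContDiff ℝ ∞ (fun x : SpaceR3 => ((x l : ℝ) : ℂ)) :=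
  Complex.ofRealCLM.contDiff.comp (EuclideanSpace.proj (𝕜 := ℝ) l).contDiff

/-- Multiplication by a matrix as a real-linear continuous map. -/
def mulVecL (M : Matrix (Fin 2 ⊕ Fin 2) (Fin 2 ⊕ Fin 2) ℂ) : Spinor →L[ℝ] Spinor :=
  (LinearMap.toContinuousLinearMap (Matrix.mulVecLin M)).restrictScalars ℝ

lemma mulVecL_apply (M : Matrix (Fin 2 ⊕ Fin 2) (Fin 2 ⊕ Fin 2) ℂ) (v : Spinor) :
    mulVecL M v = M *ᵥ v := rfl

namespace IsTest

variable {u v : SpaceR3 → Spinor}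

lemma differentiable (hu : IsTest u) : Differentiable ℝ u :=
  hu.smooth.differentiable (by simp)

lemma add (hu : IsTest u) (hv : IsTest v) : IsTest (fun x => u x + v x) :=
  ⟨hu.smooth.add hv.smooth, hu.compact.add hv.compact⟩

lemma sub (hu : IsTest u) (hv : IsTest v) : IsTest (fun x => u x - v x) :=
  ⟨hu.smooth.sub hv.smooth, hu.compact.sub hv.compact⟩

lemma const_smul (c : ℂ) (hu : IsTest u) : IsTest (fun x => c • u x) :=
  ⟨hu.smooth.const_smul c, hu.compact.smul_left (f := fun _ => c)⟩

lemma coord_smul (l : Fin 3) (hu : IsTest u) : IsTest (fun x => ((x l : ℝ) : ℂ) • u x) :=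
  ⟨(contDiff_coord l).smul hu.smooth, hu.compact.mono fun x hx h => hx (by simp [h])⟩

lemma mulVec (M : Matrix (Fin 2 ⊕ Fin 2) (Fin 2 ⊕ Fin 2) ℂ) (hu : IsTest u) :
    IsTest (fun x => M *ᵥ u x) :=
  ⟨(mulVecL M).contDiff.comp hu.smooth, hu.compact.comp_left (g := fun w => M *ᵥ w) (by simp)⟩

lemma pd (k : Fin 3) (hu : IsTest u) : IsTest (pd k u) :=
  ⟨(hu.smooth.fderiv_right (m := ∞) (by simp)).clm_apply contDiff_const,
    hu.compact.fderiv_apply (𝕜 := ℝ) _⟩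

lemma sum {κ : Type*} [Fintype κ] {f : κ → SpaceR3 → Spinor} (hf : ∀ j, IsTest (f j)) :
    IsTest (fun x => ∑ j, f j x) := by
  refine ⟨ContDiff.sum fun j _ => (hf j).smooth, ?_⟩
  have h : ∀ s : Finset κ, HasCompactSupport (fun x => ∑ j ∈ s, f j x) := by
    classical
    intro s
    induction s using Finset.induction_on with
    | empty => exact HasCompactSupport.zero
    | insert j s hj ih =>
      simp only [Finset.sum_insert hj]
      exact (hf j).compact.add ih
  exact h Finset.univ

lemma angL (j : Fin 3) (hu : IsTest u) : IsTest (angL j u) :=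
  (((hu.pd (j + 2)).coord_smul (j + 1)).sub ((hu.pd (j + 1)).coord_smul (j + 2))).const_smul _

lemma opK (hu : IsTest u) : IsTest (opK u) :=
  hu.add ((sum fun j => (hu.angL j).mulVec (spinS j)).const_smul 2)

lemma continuous_pairing (hu : IsTest u) (hv : IsTest v) :
    Continuous fun x => pairing (u x) (v x) :=
  (pairingL.continuous.comp hu.smooth.continuous).clm_apply hv.smooth.continuous

lemma integrable_pairing (hu : IsTest u) (hv : IsTest v) :
    Integrable fun x => pairing (u x) (v x) := by
  refine (hu.continuous_pairing hv).integrable_of_hasCompactSupport ?_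
  exact hu.compact.mono fun x hx h => hx (by simp [h, pairing])

/-- Integration by parts for the spinor pairing. -/
lemma integral_pairing_pd (k : Fin 3) (hu : IsTest u) (hv : IsTest v) :
    ∫ x, pairing (_root_.pd k u x) (v x) = -∫ x, pairing (u x) (_root_.pd k v x) := by
  rw [eq_comm, neg_eq_iff_eq_neg]
  exact integral_bilinear_fderiv_right_eq_neg_left_of_integrable (μ := volume) (B := pairingL)
    (v := EuclideanSpace.single k (1 : ℝ)) ((hu.pd k).integrable_pairing hv)
    (hu.integrable_pairing (hv.pd k)) (hu.integrable_pairing hv)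
    (fun x _ => hu.differentiable x) (fun x _ => hv.differentiable x)

end IsTest

section Derivatives

variable {u v : SpaceR3 → Spinor} {x : SpaceR3}

lemma pd_add (k : Fin 3) (hu : DifferentiableAt ℝ u x) (hv : DifferentiableAt ℝ v x) :
    pd k (fun y => u y + v y) x = pd k u x + pd k v x := by
  simp only [pd, fderiv_fun_add hu hv, _root_.add_apply]

lemma pd_sub (k : Fin 3) (hu : DifferentiableAt ℝ u x) (hv : DifferentiableAt ℝ v x) :
    pd k (fun y => u y - v y) x = pd k u x - pd k v x := by
  simp only [pd, fderiv_fun_sub hu hv, _root_.sub_apply]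

lemma pd_const_smul (k : Fin 3) (c : ℂ) (hu : DifferentiableAt ℝ u x) :
    pd k (fun y => c • u y) x = c • pd k u x := by
  simp only [pd, fderiv_fun_const_smul hu c, _root_.smul_apply]

lemma pd_mulVec (k : Fin 3) (M : Matrix (Fin 2 ⊕ Fin 2) (Fin 2 ⊕ Fin 2) ℂ)
    (hu : DifferentiableAt ℝ u x) : pd k (fun y => M *ᵥ u y) x = M *ᵥ pd k u x := by
  have h := (mulVecL M).hasFDerivAt.comp x hu.hasFDerivAt
  have h' : HasFDerivAt (fun y => M *ᵥ u y) ((mulVecL M).comp (fderiv ℝ u x)) x := h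
  simp only [pd, h'.fderiv, ContinuousLinearMap.comp_apply, mulVecL_apply]

lemma pd_sum {κ : Type*} [Fintype κ] (k : Fin 3) {f : κ → SpaceR3 → Spinor}
    (hf : ∀ j, DifferentiableAt ℝ (f j) x) :
    pd k (fun y => ∑ j, f j y) x = ∑ j, pd k (f j) x := by
  simp only [pd, fderiv_fun_sum fun j _ => hf j, _root_.sum_apply]

lemma pd_coord_smul (k l : Fin 3) (hu : DifferentiableAt ℝ u x) :
    pd k (fun y => ((y l : ℝ) : ℂ) • u y) x =
      ((x l : ℝ) : ℂ) • pd k u x + (if l = k then (1 : ℂ) else 0) • u x := by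
  have hl : HasFDerivAt (fun y : SpaceR3 => ((y l : ℝ) : ℂ))
      (Complex.ofRealCLM.comp (EuclideanSpace.proj (𝕜 := ℝ) l)) x :=
    (Complex.ofRealCLM.comp (EuclideanSpace.proj (𝕜 := ℝ) l)).hasFDerivAt
  have h := hl.fun_smul hu.hasFDerivAt
  simp only [pd]
  rw [HasFDerivAt.fderiv h]
  by_cases hlk : l = k <;> simp [hlk]

lemma pd_comm (k l : Fin 3) (hu : ContDiff ℝ ∞ u) : pd k (pd l u) x = pd l (pd k u) x := by
  have hd : DifferentiableAt ℝ (fderiv ℝ u) x :=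
    (hu.fderiv_right (m := ∞) (by simp)).differentiable (by simp) x
  have h : IsSymmSndFDerivAt ℝ u x :=
    hu.contDiffAt.isSymmSndFDerivAt (by
      rw [minSmoothness_of_isRCLikeNormedField]; exact WithTop.coe_le_coe.2 (le_top : (2 : ℕ∞) ≤ ⊤))
  have key : ∀ a b : Fin 3, pd a (pd b u) x =
      fderiv ℝ (fderiv ℝ u) x (EuclideanSpace.single a 1) (EuclideanSpace.single b 1) := by
    intro a b
    have : HasFDerivAt (pd b u) _ x :=
      hd.hasFDerivAt.clm_apply (hasFDerivAt_const (EuclideanSpace.single b (1 : ℝ)) x)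
    simp only [pd] at this ⊢
    rw [this.fderiv]
    simp
  rw [key, key, h.eq]

/-- The derivative in the direction `k` of a scalar multiple. -/
lemma pd_real_smul (k : Fin 3) {f : SpaceR3 → ℝ} {c : ℝ}
    (hf : HasFDerivAt f (c • innerSL ℝ x) x) (hu : DifferentiableAt ℝ u x) :
    pd k (fun y => f y • u y) x =
      (f x : ℂ) • pd k u x + ((c : ℂ) * ((x k : ℝ) : ℂ)) • u x := by
  have h := hf.fun_smul hu.hasFDerivAt
  simp only [pd]
  rw [HasFDerivAt.fderiv h]
  ext i
  simp [EuclideanSpace.inner_single_right]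

end Derivatives

section MatrixIdentities

lemma conjTranspose_Pauli (j : Fin 3) : (Pauli j)ᴴ = Pauli j := by
  ext a b
  fin_cases j <;> fin_cases a <;> fin_cases b <;> simp [Pauli]

lemma conjTranspose_spinS (j : Fin 3) : (spinS j)ᴴ = spinS j := by
  simp [spinS, fromBlocks_conjTranspose, conjTranspose_smul, conjTranspose_Pauli]

lemma conjTranspose_diracAlpha (j : Fin 3) : (diracAlpha j)ᴴ = diracAlpha j := by
  simp [diracAlpha, fromBlocks_conjTranspose, conjTranspose_Pauli]

lemma conjTranspose_diracBeta : diracBetaᴴ = diracBeta := by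
  simp [diracBeta, fromBlocks_conjTranspose]

lemma commute_diracBeta_spinS (j : Fin 3) : Commute diracBeta (spinS j) := by
  simp [Commute, SemiconjBy, diracBeta, spinS, fromBlocks_multiply]

lemma diracBeta_mul_self : diracBeta * diracBeta = 1 := by
  simp [diracBeta, fromBlocks_multiply]

/-- The matrix `α·x`. -/
def alphaDot (x : SpaceR3) : Matrix (Fin 2 ⊕ Fin 2) (Fin 2 ⊕ Fin 2) ℂ :=
  ∑ j, ((x j : ℝ) : ℂ) • diracAlpha j

lemma conjTranspose_alphaDot (x : SpaceR3) : (alphaDot x)ᴴ = alphaDot x := by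
  simp [alphaDot, conjTranspose_sum, conjTranspose_smul, conjTranspose_diracAlpha]

lemma diracBeta_mul_alphaDot (x : SpaceR3) :
    diracBeta * alphaDot x = -(alphaDot x * diracBeta) := by
  have h : ∀ j, diracBeta * diracAlpha j = -(diracAlpha j * diracBeta) := fun j => by
    simp [diracBeta, diracAlpha, fromBlocks_multiply, fromBlocks_neg]
  simp [alphaDot, Finset.mul_sum, Finset.sum_mul, h]

lemma alphaDot_mul_self (x : SpaceR3) :
    alphaDot x * alphaDot x = ((‖x‖ ^ 2 : ℝ) : ℂ) • 1 := by
  rw [EuclideanSpace.norm_sq_eq]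
  ext a b
  rcases a with a | a <;> rcases b with b | b <;> fin_cases a <;> fin_cases b <;>
    simp [alphaDot, diracAlpha, Pauli, Fin.sum_univ_three, Matrix.mul_apply] <;>
    ring_nf <;> simp

end MatrixIdentities

section Operators

variable {u v : SpaceR3 → Spinor} {x : SpaceR3}

/-- The generator of dilations, `x·∇ + 3/2`. -/
def dil (u : SpaceR3 → Spinor) (x : SpaceR3) : Spinor :=
  (∑ k, ((x k : ℝ) : ℂ) • pd k u x) + (3 / 2 : ℂ) • u x

lemma IsTest.dil (hu : IsTest u) : IsTest (dil u) :=
  (IsTest.sum fun k => (hu.pd k).coord_smul k).add (hu.const_smul _)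

lemma IsTest.alphaDot (hu : IsTest u) : IsTest (fun y => alphaDot y *ᵥ u y) := by
  simp only [DiracCrossTerm.alphaDot, sum_mulVec, smul_mulVec]
  exact IsTest.sum fun j => (hu.mulVec (diracAlpha j)).coord_smul j

lemma integral_pairing_coord_smul_pd (k l : Fin 3) (hu : IsTest u) (hv : IsTest v) :
    ∫ x, pairing (((x l : ℝ) : ℂ) • pd k u x) (v x) =
      -(∫ x, pairing (u x) (((x l : ℝ) : ℂ) • pd k v x)) -
        (if l = k then 1 else 0) * ∫ x, pairing (u x) (v x) := by
  have h := hu.integral_pairing_pd k (hv.coord_smul l)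
  simp only [pd_coord_smul k l (hv.differentiable _), pairing_add_right] at h
  rw [integral_add (hu.integrable_pairing ((hv.pd k).coord_smul l))
    (hu.integrable_pairing (hv.const_smul _))] at h
  have hl : ∀ x : SpaceR3, pairing (((x l : ℝ) : ℂ) • pd k u x) (v x) =
      pairing (pd k u x) (((x l : ℝ) : ℂ) • v x) := fun x => by
    rw [pairing_smul_left, pairing_smul_right, Complex.conj_ofReal]
  have hδ : (starRingEnd ℂ) (if l = k then (1 : ℂ) else 0) = if l = k then 1 else 0 := by
    split_ifs <;> simp
  simp only [hl, h, pairing_smul_right (ite _ _ _), integral_const_mul, hδ]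
  ring

lemma integral_pairing_dil (hu : IsTest u) (hv : IsTest v) :
    ∫ x, pairing (dil u x) (v x) = -∫ x, pairing (u x) (dil v x) := by
  simp only [dil, pairing_add_left, pairing_add_right, pairing_sum_left, pairing_sum_right]
  rw [integral_add (integrable_finsetSum _ fun k _ =>
      ((hu.pd k).coord_smul k).integrable_pairing hv)
      ((hu.const_smul _).integrable_pairing hv),
    integral_add (integrable_finsetSum _ fun k _ =>
      hu.integrable_pairing ((hv.pd k).coord_smul k))
      (hu.integrable_pairing (hv.const_smul _)),
    integral_finsetSum _ fun k _ => ((hu.pd k).coord_smul k).integrable_pairing hv,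
    integral_finsetSum _ fun k _ => hu.integrable_pairing ((hv.pd k).coord_smul k)]
  simp only [integral_pairing_coord_smul_pd _ _ hu hv]
  simp only [pairing_smul_left, pairing_smul_right, integral_const_mul, Fin.sum_univ_three,
    map_div₀, map_ofNat, if_true]
  ring

lemma integral_pairing_angL (j : Fin 3) (hu : IsTest u) (hv : IsTest v) :
    ∫ x, pairing (angL j u x) (v x) = ∫ x, pairing (u x) (angL j v x) := by
  have h₁ := integral_pairing_coord_smul_pd (j + 2) (j + 1) hu hv
  have h₂ := integral_pairing_coord_smul_pd (j + 1) (j + 2) hu hv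
  rw [if_neg (by fin_cases j <;> decide)] at h₁ h₂
  simp only [angL]
  simp only [pairing_smul_left (-Complex.I), pairing_smul_right (-Complex.I),
    pairing_sub_left, pairing_sub_right, integral_const_mul]
  rw [integral_sub (((hu.pd _).coord_smul _).integrable_pairing hv)
      (((hu.pd _).coord_smul _).integrable_pairing hv),
    integral_sub (hu.integrable_pairing ((hv.pd _).coord_smul _))
      (hu.integrable_pairing ((hv.pd _).coord_smul _)), h₁, h₂]
  simp only [map_neg, Complex.conj_I]
  ring

lemma angL_mulVec (j : Fin 3) (M : Matrix (Fin 2 ⊕ Fin 2) (Fin 2 ⊕ Fin 2) ℂ)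
    (hu : DifferentiableAt ℝ u x) : angL j (fun y => M *ᵥ u y) x = M *ᵥ angL j u x := by
  simp only [angL, pd_mulVec _ M hu, mulVec_smul, mulVec_sub]

lemma opK_mulVec {M : Matrix (Fin 2 ⊕ Fin 2) (Fin 2 ⊕ Fin 2) ℂ}
    (hM : ∀ j, Commute M (spinS j)) (hu : DifferentiableAt ℝ u x) :
    opK (fun y => M *ᵥ u y) x = M *ᵥ opK u x := by
  simp only [opK, angL_mulVec _ M hu, mulVec_add, mulVec_smul, mulVec_sum, mulVec_mulVec,
    (hM _).eq]

/-- The spin-orbit operator is symmetric. -/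
lemma integral_pairing_opK (hu : IsTest u) (hv : IsTest v) :
    ∫ x, pairing (opK u x) (v x) = ∫ x, pairing (u x) (opK v x) := by
  have hS : ∀ j, ∫ x, pairing (spinS j *ᵥ angL j u x) (v x) =
      ∫ x, pairing (u x) (spinS j *ᵥ angL j v x) := fun j => by
    simp only [pairing_mulVec_left, conjTranspose_spinS]
    rw [integral_pairing_angL j hu (hv.mulVec _)]
    simp only [angL_mulVec j (spinS j) (hv.differentiable _)]
  have hl : ∀ j, Integrable fun x => pairing (spinS j *ᵥ angL j u x) (v x) :=
    fun j => ((hu.angL j).mulVec _).integrable_pairing hv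
  have hr : ∀ j, Integrable fun x => pairing (u x) (spinS j *ᵥ angL j v x) :=
    fun j => hu.integrable_pairing ((hv.angL j).mulVec _)
  simp only [opK, pairing_add_left, pairing_add_right, pairing_smul_left, pairing_smul_right,
    pairing_sum_left, pairing_sum_right, map_ofNat]
  rw [integral_add (hu.integrable_pairing hv)
      ((integrable_finsetSum _ fun j _ => hl j).const_mul _),
    integral_add (hu.integrable_pairing hv)
      ((integrable_finsetSum _ fun j _ => hr j).const_mul _),
    integral_const_mul, integral_const_mul, integral_finsetSum _ fun j _ => hl j,
    integral_finsetSum _ fun j _ => hr j]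
  simp only [hS]

lemma dil_mulVec (M : Matrix (Fin 2 ⊕ Fin 2) (Fin 2 ⊕ Fin 2) ℂ)
    (hu : DifferentiableAt ℝ u x) : dil (fun y => M *ᵥ u y) x = M *ᵥ dil u x := by
  simp only [dil, pd_mulVec _ M hu, mulVec_add, mulVec_smul, mulVec_sum]

lemma dil_angL (j : Fin 3) (hu : IsTest u) : dil (angL j u) x = angL j (dil u) x := by
  have h₁ : ∀ k, pd k (angL j u) x = -Complex.I •
      ((((x (j + 1) : ℝ) : ℂ) • pd k (pd (j + 2) u) x +
          (if j + 1 = k then (1 : ℂ) else 0) • pd (j + 2) u x) -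
        (((x (j + 2) : ℝ) : ℂ) • pd k (pd (j + 1) u) x +
          (if j + 2 = k then (1 : ℂ) else 0) • pd (j + 1) u x)) := fun k => by
    have ha := (hu.pd (j + 2)).coord_smul (j + 1)
    have hb := (hu.pd (j + 1)).coord_smul (j + 2)
    unfold angL
    rw [pd_const_smul k _ ((ha.sub hb).differentiable x),
      pd_sub k (ha.differentiable x) (hb.differentiable x),
      pd_coord_smul k _ ((hu.pd _).differentiable x),
      pd_coord_smul k _ ((hu.pd _).differentiable x)]
  have h₂ : ∀ k, pd k (dil u) x = (∑ l, (((x l : ℝ) : ℂ) • pd k (pd l u) x +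
      (if l = k then (1 : ℂ) else 0) • pd l u x)) + (3 / 2 : ℂ) • pd k u x := fun k => by
    have ha : ∀ l, IsTest fun y => ((y l : ℝ) : ℂ) • pd l u y := fun l => (hu.pd l).coord_smul l
    unfold dil
    rw [pd_add k ((IsTest.sum ha).differentiable x) ((hu.const_smul _).differentiable x),
      pd_sum k (fun l => (ha l).differentiable x), pd_const_smul k _ (hu.differentiable x)]
    simp only [pd_coord_smul k _ ((hu.pd _).differentiable x)]
  rw [dil, angL.eq_1 j (dil u), h₂, h₂, angL]
  simp only [h₁]
  have h10 := pd_comm (x := x) 1 0 hu.smooth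
  have h20 := pd_comm (x := x) 2 0 hu.smooth
  have h21 := pd_comm (x := x) 2 1 hu.smooth
  ext i
  fin_cases j <;> simp [Fin.sum_univ_three, h10, h20, h21] <;> ring

/-- The spin-orbit operator commutes with dilations. -/
lemma opK_dil (hu : IsTest u) : opK (dil u) x = dil (opK u) x := by
  have h : dil (opK u) x = dil u x + (2 : ℂ) • ∑ j, dil (fun y => spinS j *ᵥ angL j u y) x := by
    have ha : ∀ j, IsTest fun y => spinS j *ᵥ angL j u y := fun j => (hu.angL j).mulVec _
    have hk : ∀ k, pd k (opK u) x =
        pd k u x + (2 : ℂ) • ∑ j, pd k (fun y => spinS j *ᵥ angL j u y) x := fun k => by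
      unfold opK
      rw [pd_add k (hu.differentiable x) (((IsTest.sum ha).const_smul 2).differentiable x),
        pd_const_smul k _ ((IsTest.sum ha).differentiable x),
        pd_sum k fun j => (ha j).differentiable x]
    simp only [dil, hk, opK]
    simp only [Fin.sum_univ_three]
    module
  rw [h, opK]
  simp only [dil_mulVec _ ((hu.angL _).differentiable x), dil_angL _ hu]

lemma pd_alphaDot (k : Fin 3) (hu : IsTest u) :
    pd k (fun y => alphaDot y *ᵥ u y) x =
      alphaDot x *ᵥ pd k u x + diracAlpha k *ᵥ u x := by
  have ha : ∀ j, IsTest fun y => ((y j : ℝ) : ℂ) • (diracAlpha j *ᵥ u y) :=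
    fun j => (hu.mulVec (diracAlpha j)).coord_smul j
  simp only [alphaDot, sum_mulVec, smul_mulVec]
  rw [pd_sum k fun j => (ha j).differentiable x]
  simp only [pd_coord_smul k _ ((hu.mulVec _).differentiable x),
    pd_mulVec k _ (hu.differentiable x), Finset.sum_add_distrib]
  simp

/-- The spin-orbit operator anticommutes with `α·x`. -/
lemma opK_alphaDot (hu : IsTest u) :
    opK (fun y => alphaDot y *ᵥ u y) x = -(alphaDot x *ᵥ opK u x) := by
  simp only [opK, angL, pd_alphaDot _ hu]
  ext i
  rcases i with i | i <;> fin_cases i <;>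
    simp [alphaDot, diracAlpha, spinS, Pauli, Fin.sum_univ_three, Matrix.mulVec, dotProduct] <;>
    ring_nf <;> simp [Complex.I_sq] <;> ring

lemma alphaDot_mulVec_diracKin (u : SpaceR3 → Spinor) (x : SpaceR3) :
    alphaDot x *ᵥ diracKin u x =
      -Complex.I • ((∑ k, ((x k : ℝ) : ℂ) • pd k u x) + u x - opK u x) := by
  simp only [opK, angL, diracKin]
  ext i
  rcases i with i | i <;> fin_cases i <;>
    simp [alphaDot, diracAlpha, spinS, Pauli, Fin.sum_univ_three, Matrix.mulVec, dotProduct] <;>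
    ring_nf <;> simp [Complex.I_sq] <;> ring

end Operators

section Vanishing

variable {u : SpaceR3 → Spinor}

lemma integral_pairing_conj (u v : SpaceR3 → Spinor) :
    ∫ x, pairing (v x) (u x) = (starRingEnd ℂ) (∫ x, pairing (u x) (v x)) := by
  rw [← integral_conj]
  simp only [conj_pairing]

/-- Symmetric and antisymmetric commuting operators have a purely imaginary cross term. -/
lemma re_integral_pairing_dil {B : Matrix (Fin 2 ⊕ Fin 2) (Fin 2 ⊕ Fin 2) ℂ} (hB : Bᴴ = B)
    (hBS : ∀ j, Commute B (spinS j)) (hu : IsTest u) :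
    (∫ x, pairing (dil u x) (B *ᵥ opK u x)).re = 0 := by
  have h : ∫ x, pairing (dil u x) (B *ᵥ opK u x) =
      -(starRingEnd ℂ) (∫ x, pairing (dil u x) (B *ᵥ opK u x)) :=
    calc ∫ x, pairing (dil u x) (B *ᵥ opK u x)
        = -∫ x, pairing (u x) (B *ᵥ opK (dil u) x) := by
          rw [integral_pairing_dil hu (hu.opK.mulVec B)]
          simp only [dil_mulVec B (hu.opK.differentiable _), opK_dil hu]
      _ = -∫ x, pairing (opK (fun y => B *ᵥ u y) x) (dil u x) := by
          rw [integral_pairing_opK (hu.mulVec B) hu.dil]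
          simp only [pairing_mulVec_left, hB]
      _ = -∫ x, pairing (B *ᵥ opK u x) (dil u x) := by
          simp only [opK_mulVec hBS (hu.differentiable _)]
      _ = _ := by rw [integral_pairing_conj]
  have := congrArg Complex.re h
  simp only [Complex.neg_re, Complex.conj_re] at this
  linarith

lemma im_integral_pairing_diracBeta_alphaDot (hu : IsTest u) :
    (∫ x, pairing (diracBeta *ᵥ alphaDot x *ᵥ u x) (opK u x)).im = 0 := by
  have hpt : ∀ x, pairing (opK (fun y => diracBeta *ᵥ alphaDot y *ᵥ u y) x) (u x) =
      pairing (opK u x) (diracBeta *ᵥ alphaDot x *ᵥ u x) := fun x => by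
    rw [opK_mulVec commute_diracBeta_spinS (hu.alphaDot.differentiable _), opK_alphaDot hu,
      mulVec_neg, mulVec_mulVec, diracBeta_mul_alphaDot, neg_mulVec, neg_neg,
      pairing_mulVec_left, conjTranspose_mul, conjTranspose_alphaDot, conjTranspose_diracBeta,
      ← mulVec_mulVec]
  have h := integral_pairing_opK (hu.alphaDot.mulVec diracBeta) hu
  simp only [hpt] at h
  rw [integral_pairing_conj] at h
  exact Complex.conj_eq_iff_im.1 h

end Vanishing

section Radial

variable {u v : SpaceR3 → Spinor} {x : SpaceR3}

lemma hasFDerivAt_comp_norm {g : ℝ → ℝ} {g' : ℝ} (hx : x ≠ 0) (hg : HasDerivAt g g' ‖x‖) :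
    HasFDerivAt (fun y : SpaceR3 => g ‖y‖) ((g' / ‖x‖) • innerSL ℝ x) x := by
  have hn : ‖x‖ ≠ 0 := norm_ne_zero_iff.2 hx
  have h₁ := (hasStrictFDerivAt_norm_sq x).hasFDerivAt.sqrt (pow_ne_zero 2 hn)
  have h₂ : HasFDerivAt (fun y : SpaceR3 => ‖y‖) ((1 / ‖x‖) • innerSL ℝ x) x := by
    convert! h₁ using 1
    · ext y; simp [Real.sqrt_sq]
    · ext y
      simp [Real.sqrt_sq]
      field_simp
  convert! hg.comp_hasFDerivAt x h₂ using 1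
  rw [smul_smul]
  ring_nf

lemma opK_congr (h : u =ᶠ[nhds x] v) : opK u x = opK v x := by
  simp only [opK, angL, pd, h.fderiv_eq, h.eq_of_nhds]

lemma diracKin_congr (h : u =ᶠ[nhds x] v) : diracKin u x = diracKin v x := by
  simp only [diracKin, pd, h.fderiv_eq]

lemma opK_zero (x : SpaceR3) : opK (fun _ => 0) x = 0 := by
  simp [opK, angL, pd]

/-- The spin-orbit operator commutes with radial functions. -/
lemma opK_radial_smul {f : SpaceR3 → ℝ} {c : ℝ} (hf : HasFDerivAt f (c • innerSL ℝ x) x)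
    (hu : DifferentiableAt ℝ u x) : opK (fun y => f y • u y) x = (f x : ℂ) • opK u x := by
  have h : ∀ j, angL j (fun y => f y • u y) x = (f x : ℂ) • angL j u x := fun j => by
    simp only [angL, pd_real_smul _ hf hu]
    module
  simp only [opK, h, mulVec_smul, ← Finset.smul_sum, smul_add, Complex.coe_smul]
  rw [smul_comm]

lemma diracKin_radial_smul {f : SpaceR3 → ℝ} {c : ℝ} (hf : HasFDerivAt f (c • innerSL ℝ x) x)
    (hu : DifferentiableAt ℝ u x) :
    diracKin (fun y => f y • u y) x =
      (f x : ℂ) • diracKin u x + (-Complex.I * c) • (alphaDot x *ᵥ u x) := by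
  simp only [diracKin, pd_real_smul _ hf hu, alphaDot, mulVec_add, mulVec_smul,
    Fin.sum_univ_three, add_mulVec, smul_mulVec]
  module

/-- The rescaled field `|x|^{-1/2} u`. -/
def rescale (u : SpaceR3 → Spinor) (x : SpaceR3) : Spinor := (√‖x‖)⁻¹ • u x

lemma isTest_rescale (hs : ContDiff ℝ ∞ u) (hc : HasCompactSupport u) (h0 : 0 ∉ tsupport u) :
    IsTest (rescale u) := by
  refine ⟨contDiff_iff_contDiffAt.2 fun x => ?_, hc.mono fun x hx h => hx (by simp [rescale, h])⟩
  by_cases hx : x ∈ tsupport u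
  · have hx0 : x ≠ 0 := fun h => h0 (h ▸ hx)
    have hn : ‖x‖ ≠ 0 := norm_ne_zero_iff.2 hx0
    have hsq : √‖x‖ ≠ 0 := (Real.sqrt_pos.2 (norm_pos_iff.2 hx0)).ne'
    exact (((contDiffAt_norm ℝ hx0).sqrt hn).inv hsq).smul hs.contDiffAt
  · have h := notMem_tsupport_iff_eventuallyEq.1 hx
    refine (contDiffAt_const (c := (0 : Spinor))).congr_of_eventuallyEq ?_
    filter_upwards [h] with y hy
    simp [rescale, hy]

lemma eventuallyEq_sqrt_smul_rescale (hx : x ≠ 0) :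
    u =ᶠ[nhds x] fun y => √‖y‖ • rescale u y := by
  filter_upwards [isOpen_ne.mem_nhds hx] with y hy
  rw [rescale, smul_inv_smul₀ (Real.sqrt_pos.2 (norm_pos_iff.2 hy)).ne']

lemma norm_inv_smul_eq (u : SpaceR3 → Spinor) :
    (fun y => ‖y‖⁻¹ • u y) = fun y => (√‖y‖)⁻¹ • rescale u y := by
  ext1 y
  rw [rescale, smul_smul, ← mul_inv, Real.mul_self_sqrt (norm_nonneg y)]

end Radial

section CrossTerm

variable {u : SpaceR3 → Spinor}

lemma one_sub_smul_diracBeta_mul (c : ℝ) (x : SpaceR3) :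
    (1 - (c : ℂ) • diracBeta) * (alphaDot x * (diracBeta - (c : ℂ) • 1)) =
      (-(1 - (c : ℂ) ^ 2)) • (diracBeta * alphaDot x) := by
  have h : alphaDot x * diracBeta = -(diracBeta * alphaDot x) := by
    rw [diracBeta_mul_alphaDot, neg_neg]
  have h' : diracBeta * (diracBeta * alphaDot x) = alphaDot x := by
    rw [← mul_assoc, diracBeta_mul_self, one_mul]
  simp only [mul_sub, sub_mul, h, mul_smul_comm, smul_mul_assoc, mul_one, one_mul, mul_neg, h']
  module

lemma conjTranspose_one_sub_smul_diracBeta (c : ℝ) :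
    (1 - (c : ℂ) • diracBeta)ᴴ = 1 - (c : ℂ) • diracBeta := by
  simp [conjTranspose_sub, conjTranspose_smul, conjTranspose_diracBeta]

lemma commute_one_sub_smul_diracBeta_spinS (c : ℝ) (j : Fin 3) :
    Commute (1 - (c : ℂ) • diracBeta) (spinS j) :=
  (Commute.one_left _).sub_left ((commute_diracBeta_spinS j).smul_left _)

lemma opK_eq_zero_of_notMem_tsupport {x : SpaceR3} (f : SpaceR3 → ℝ) (hx : x ∉ tsupport u) :
    opK (fun y => f y • u y) x = 0 := by
  have h := notMem_tsupport_iff_eventuallyEq.1 hx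
  rw [← opK_zero x]
  refine opK_congr ?_
  filter_upwards [h] with y hy
  simp [hy]

/-- The right-hand integrand in terms of the rescaled field. -/
lemma pairing_opK_norm_inv_smul (hu : IsTest (rescale u)) (h0 : 0 ∉ tsupport u)
    (B : Matrix (Fin 2 ⊕ Fin 2) (Fin 2 ⊕ Fin 2) ℂ) (x : SpaceR3) :
    pairing (opK (fun y => ‖y‖⁻¹ • u y) x) (B *ᵥ opK u x) =
      pairing (opK (rescale u) x) (B *ᵥ opK (rescale u) x) := by
  by_cases hx : x = 0
  · subst hx
    rw [opK_eq_zero_of_notMem_tsupport _ h0]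
    have : opK (rescale u) 0 = 0 := opK_eq_zero_of_notMem_tsupport (fun y => (√‖y‖)⁻¹) h0
    rw [this]
    simp [pairing]
  · have hn : ‖x‖ ≠ 0 := norm_ne_zero_iff.2 hx
    have hs : √‖x‖ ≠ 0 := (Real.sqrt_pos.2 (norm_pos_iff.2 hx)).ne'
    have hsc : (√‖x‖ : ℂ) ≠ 0 := Complex.ofReal_ne_zero.2 hs
    have hsq := Real.hasDerivAt_sqrt hn
    rw [norm_inv_smul_eq, opK_congr (eventuallyEq_sqrt_smul_rescale (u := u) hx),
      opK_radial_smul (hasFDerivAt_comp_norm hx hsq) (hu.differentiable x),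
      opK_radial_smul (hasFDerivAt_comp_norm hx (hsq.fun_inv hs)) (hu.differentiable x),
      mulVec_smul, pairing_smul_left, pairing_smul_right, Complex.conj_ofReal,
      Complex.ofReal_inv, ← mul_assoc, inv_mul_cancel₀ hsc, one_mul]

/-- The left-hand integrand in terms of the rescaled field, by the polar decomposition of
`-iα·∇`. -/
lemma pairing_dirac_eq {m : ℝ} (hm : m ≠ 0) (a : ℝ) (hu : IsTest (rescale u))
    (h0 : 0 ∉ tsupport u) (x : SpaceR3) :
    pairing (diracKin u x + (m : ℂ) • diracBeta *ᵥ u x - (a : ℂ) • u x)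
        ((∑ j, ((x j / ‖x‖ : ℝ) : ℂ) • diracAlpha j) *ᵥ
          (Complex.I • (1 - ((a / m : ℝ) : ℂ) • diracBeta) *ᵥ opK u x)) =
      pairing (opK (rescale u) x)
          ((1 - ((a / m : ℝ) : ℂ) • diracBeta) *ᵥ opK (rescale u) x) -
        pairing (dil (rescale u) x)
          ((1 - ((a / m : ℝ) : ℂ) • diracBeta) *ᵥ opK (rescale u) x) +
        ((m * (1 - (a / m) ^ 2) : ℝ) : ℂ) * Complex.I *
          pairing (diracBeta *ᵥ alphaDot x *ᵥ rescale u x) (opK (rescale u) x) := by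
  by_cases hx : x = 0
  · subst hx
    have : opK (rescale u) 0 = 0 := opK_eq_zero_of_notMem_tsupport (fun y => (√‖y‖)⁻¹) h0
    rw [this]
    simp [pairing]
  have hn : ‖x‖ ≠ 0 := norm_ne_zero_iff.2 hx
  have hs : √‖x‖ ≠ 0 := (Real.sqrt_pos.2 (norm_pos_iff.2 hx)).ne'
  have hsqrt : HasFDerivAt (fun y : SpaceR3 => √‖y‖) _ x :=
    hasFDerivAt_comp_norm hx (Real.hasDerivAt_sqrt hn)
  have hev := eventuallyEq_sqrt_smul_rescale (u := u) hx
  set φ := rescale u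
  set s : ℝ := √‖x‖ with hs_def
  have hr : ‖x‖ = s ^ 2 := (Real.sq_sqrt (norm_nonneg x)).symm
  set c : ℝ := a / m with hc_def
  have ha : a = m * c := by rw [hc_def]; field_simp
  set w : Spinor := (1 - (c : ℂ) • diracBeta) *ᵥ opK φ x with hw
  have hux : u x = (s : ℂ) • φ x := hev.eq_of_nhds
  have hX : ∑ j, ((x j / ‖x‖ : ℝ) : ℂ) • diracAlpha j = ((s ^ 2 : ℝ)⁻¹ : ℂ) • alphaDot x := by
    rw [alphaDot, Finset.smul_sum, hr]
    refine Finset.sum_congr rfl fun j _ => ?_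
    rw [smul_smul]
    push_cast
    ring_nf
  have hXZ : alphaDot x *ᵥ (diracKin u x + (m : ℂ) • diracBeta *ᵥ u x - (a : ℂ) • u x) =
      (s : ℂ) • (-Complex.I • (dil φ x - opK φ x) +
        (m : ℂ) • ((alphaDot x * (diracBeta - (c : ℂ) • 1)) *ᵥ φ x)) := by
    have hcoef : ((1 / (2 * s) / ‖x‖ : ℝ) : ℂ) * ((‖x‖ ^ 2 : ℝ) : ℂ) = (s : ℂ) * (1 / 2) := by
      rw [hr]
      norm_cast
      push_cast
      field_simp
    rw [diracKin_congr hev, diracKin_radial_smul hsqrt (hu.differentiable x), hux, ha]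
    simp only [mulVec_add, mulVec_sub, mulVec_smul, mulVec_mulVec, alphaDot_mul_self,
      alphaDot_mulVec_diracKin, mul_sub, sub_mulVec, mul_smul_comm, mul_one, smul_mulVec,
      one_mulVec, smul_smul]
    rw [mul_assoc (-Complex.I), hcoef, dil, Complex.ofReal_mul]
    module
  have hφw : pairing ((alphaDot x * (diracBeta - (c : ℂ) • 1)) *ᵥ φ x) w =
      -(1 - (c : ℂ) ^ 2) * pairing (diracBeta *ᵥ alphaDot x *ᵥ φ x) (opK φ x) := by
    rw [hw, ← conjTranspose_one_sub_smul_diracBeta, ← pairing_mulVec_left, mulVec_mulVec,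
      one_sub_smul_diracBeta_mul, smul_mulVec, pairing_smul_left, mulVec_mulVec]
  have hKu : opK u x = (s : ℂ) • opK φ x :=
    (opK_congr hev).trans (opK_radial_smul hsqrt (hu.differentiable x))
  simp only [hX, hKu, mulVec_smul, smul_mulVec, pairing_smul_right, ← hw]
  conv_lhs => rw [← conjTranspose_alphaDot, ← pairing_mulVec_left, hXZ]
  rw [pairing_smul_left, pairing_add_left, pairing_smul_left, pairing_smul_left,
    pairing_sub_left, hφw]
  have hsc : (s : ℂ) ≠ 0 := Complex.ofReal_ne_zero.2 hs
  simp only [map_inv₀, Complex.conj_ofReal, Complex.conj_I]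
  push_cast
  field_simp
  ring_nf
  simp only [Complex.I_sq]
  ring

lemma integral_re_sub_add_I_mul {f g h : SpaceR3 → ℂ} (hf : Integrable f) (hg : Integrable g)
    (hh : Integrable h) (hg0 : (∫ x, g x).re = 0) (hh0 : (∫ x, h x).im = 0) (t : ℝ) :
    ∫ x, (f x - g x + (t : ℂ) * Complex.I * h x).re = ∫ x, (f x).re := by
  have hth : Integrable fun x => (t : ℂ) * Complex.I * h x := hh.const_mul _
  have hfg : Integrable fun x => f x - g x := hf.sub hg
  have hl := integral_re (hfg.add hth)
  have hr := integral_re hf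
  simp only [RCLike.re_to_complex, Pi.add_apply] at hl hr
  rw [hl, hr, integral_add hfg hth, integral_sub hf hg, integral_const_mul, mul_assoc]
  simp [hg0, hh0]

end CrossTerm

end DiracCrossTerm

/-- **Cross-term identity in the proof of the sharp Dirac Hardy inequality.**
For `m > 0`, `a ∈ (-m, m)` and `ψ ∈ C_c^∞(ℝ³ \ {0})⁴`,
`-2 Re ∫ (-iα·∇ + mβ - a)ψ · conj(i α·x̂ (1 - (a/m)β)(1+2S·L)ψ) dx
  = -2 Re ∫ (1+2S·L)(ψ/|x|) · conj((1 - (a/m)β)(1+2S·L)ψ) dx`. -/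
theorem stmt_15 (m a : ℝ) (hm : 0 < m) (ha : a ∈ Set.Ioo (-m) m)
    (ψ : EuclideanSpace ℝ (Fin 3) → (Fin 2 ⊕ Fin 2) → ℂ)
    (hs : ContDiff ℝ (⊤ : ℕ∞) ψ) (hc : HasCompactSupport ψ) (h0 : 0 ∉ tsupport ψ) :
    (-2) * ∫ x : EuclideanSpace ℝ (Fin 3),
        (∑ i, (diracKin ψ x + (m : ℂ) • diracBeta.mulVec (ψ x) - (a : ℂ) • ψ x) i *
          (starRingEnd ℂ)
            (((∑ j, ((x j / ‖x‖ : ℝ) : ℂ) • diracAlpha j).mulVec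
              (Complex.I • (1 - ((a / m : ℝ) : ℂ) • diracBeta).mulVec (opK ψ x))) i)).re
      = (-2) * ∫ x : EuclideanSpace ℝ (Fin 3),
          (∑ i, opK (fun y => ‖y‖⁻¹ • ψ y) x i *
            (starRingEnd ℂ)
              (((1 - ((a / m : ℝ) : ℂ) • diracBeta).mulVec (opK ψ x)) i)).re := by
  congr 1
  have hφ := DiracCrossTerm.isTest_rescale hs hc h0
  have hB := DiracCrossTerm.re_integral_pairing_dil
    (DiracCrossTerm.conjTranspose_one_sub_smul_diracBeta (a / m))
    (DiracCrossTerm.commute_one_sub_smul_diracBeta_spinS (a / m)) hφ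
  refine (integral_congr_ae (.of_forall fun x => congrArg Complex.re
    (DiracCrossTerm.pairing_dirac_eq hm.ne' a hφ h0 x))).trans (Eq.trans ?_
      (integral_congr_ae (.of_forall fun x => congrArg Complex.re
        (DiracCrossTerm.pairing_opK_norm_inv_smul hφ h0 _ x))).symm)
  exact DiracCrossTerm.integral_re_sub_add_I_mul
    (hφ.opK.integrable_pairing (hφ.opK.mulVec _)) (hφ.dil.integrable_pairing (hφ.opK.mulVec _))
    ((hφ.alphaDot.mulVec diracBeta).integrable_pairing hφ.opK) hB
    (DiracCrossTerm.im_integral_pairing_diracBeta_alphaDot hφ) _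
end
end

section
/- Let 0 < ν < 1 and N = √((1−√(1−ν²))/(1+√(1−ν²))). Suppose V : ℝ³ \ {0} → Herm(4) satisfies (V(x) + (ν/|x|) I₄)·(C, i N (σ·x̂) C)ᵀ = 0 for every C ∈ ℂ². Then there is a 2×2 Hermitian matrix-valued function W(x) such that V(x) = −(ν/|x|) I₄ + [[N² (σ·x̂) W(x) (σ·x̂), i N (σ·x̂) W(x)],[−i N W(x) (σ·x̂), W(x)]]. -/
open Matrix

noncomputable section

/-- `σ·x̂`, with `x̂ = x/|x|`. -/
def sigmaHat (x : EuclideanSpace ℝ (Fin 3)) : Matrix (Fin 2) (Fin 2) ℂ :=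
  ∑ j, ((x j / ‖x‖ : ℝ) : ℂ) • Pauli j

/-- The constant `N = √((1-√(1-ν²))/(1+√(1-ν²)))`. -/
def Nnu (ν : ℝ) : ℝ :=
  Real.sqrt ((1 - Real.sqrt (1 - ν ^ 2)) / (1 + Real.sqrt (1 - ν ^ 2)))

theorem Pauli_isHermitian (j : Fin 3) : (Pauli j).IsHermitian := by
  fin_cases j <;> ext a b <;> fin_cases a <;> fin_cases b <;> simp [Pauli]

theorem sigmaHat_isHermitian (x : EuclideanSpace ℝ (Fin 3)) : (sigmaHat x).IsHermitian := by
  simp only [sigmaHat, Matrix.IsHermitian, conjTranspose_sum, conjTranspose_smul,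
    (Pauli_isHermitian _).eq, Complex.star_def, Complex.conj_ofReal]

/-- A Hermitian block matrix annihilating the graph of `T` is determined by its lower right
block. -/
theorem eq_fromBlocks_of_mulVec_graph_eq_zero {m n : Type*} [Fintype m]
    [Fintype n] {M : Matrix (m ⊕ n) (m ⊕ n) ℂ} (hM : M.IsHermitian) (T : Matrix n m ℂ)
    (h : ∀ C : m → ℂ, M *ᵥ Sum.elim C (T *ᵥ C) = 0) :
    M = fromBlocks (Tᴴ * M.toBlocks₂₂ * T) (-(Tᴴ * M.toBlocks₂₂)) (-(M.toBlocks₂₂ * T))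
      M.toBlocks₂₂ := by
  obtain ⟨A, B, E, D, rfl⟩ : ∃ A B E D, M = fromBlocks A B E D :=
    ⟨_, _, _, _, (fromBlocks_toBlocks M).symm⟩
  obtain ⟨-, -, hB, hD⟩ := isHermitian_fromBlocks_iff.mp hM
  have hrow (C : m → ℂ) : (A + B * T) *ᵥ C = 0 ∧ (E + D * T) *ᵥ C = 0 := by
    have hC := h C
    rw [fromBlocks_mulVec, Sum.elim_comp_inl, Sum.elim_comp_inr, mulVec_mulVec, mulVec_mulVec,
      ← add_mulVec, ← add_mulVec] at hC
    exact ⟨funext fun i => congrFun hC (.inl i), funext fun i => congrFun hC (.inr i)⟩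
  have hA : A = -(B * T) := eq_neg_of_add_eq_zero_left <|
    mulVec_injective <| funext fun C => (hrow C).1.trans (zero_mulVec C).symm
  have hE : E = -(D * T) := eq_neg_of_add_eq_zero_left <|
    mulVec_injective <| funext fun C => (hrow C).2.trans (zero_mulVec C).symm
  have hBT : B = -(Tᴴ * D) := by
    rw [← hB, hE, conjTranspose_neg, conjTranspose_mul, hD.eq]
  rw [toBlocks_fromBlocks₂₂, hA, hE, hBT, Matrix.neg_mul, neg_neg]

/-- **Rigidity of potentials annihilating the attainers.** If a Hermitian matrix-valued
potential `V` satisfies `(V(x) + (ν/|x|)I₄)·(C, iN σ·x̂ C)ᵀ = 0` for every `C ∈ ℂ²` and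
`x ≠ 0`, then there is a Hermitian `2×2` matrix-valued function `W` with
`V(x) = -(ν/|x|)I₄ + [[N² σx̂ W σx̂, iN σx̂ W], [-iN W σx̂, W]]`. -/
theorem stmt_19 (ν : ℝ) (hν : 0 < ν ∧ ν < 1)
    (V : EuclideanSpace ℝ (Fin 3) → Matrix (Fin 2 ⊕ Fin 2) (Fin 2 ⊕ Fin 2) ℂ)
    (hHerm : ∀ x : EuclideanSpace ℝ (Fin 3), x ≠ 0 → (V x).IsHermitian)
    (hker : ∀ x : EuclideanSpace ℝ (Fin 3), x ≠ 0 → ∀ C : Fin 2 → ℂ,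
      (V x + ((ν / ‖x‖ : ℝ) : ℂ) • 1).mulVec
          (Sum.elim C fun i => (Complex.I * (Nnu ν : ℝ)) * (sigmaHat x).mulVec C i) = 0) :
    ∃ W : EuclideanSpace ℝ (Fin 3) → Matrix (Fin 2) (Fin 2) ℂ,
      ∀ x : EuclideanSpace ℝ (Fin 3), x ≠ 0 →
        (W x).IsHermitian ∧
        V x = (-(ν / ‖x‖ : ℝ) : ℂ) • 1 +
          Matrix.fromBlocks
            (((Nnu ν : ℝ) ^ 2 : ℂ) • (sigmaHat x * W x * sigmaHat x))
            ((Complex.I * (Nnu ν : ℝ)) • (sigmaHat x * W x))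
            ((-Complex.I * (Nnu ν : ℝ)) • (W x * sigmaHat x))
            (W x) := by
  refine ⟨fun x => (V x + ((ν / ‖x‖ : ℝ) : ℂ) • 1).toBlocks₂₂, fun x hx => ?_⟩
  have hM : (V x + ((ν / ‖x‖ : ℝ) : ℂ) • 1).IsHermitian :=
    (hHerm x hx).add (by
      simp only [Matrix.IsHermitian, conjTranspose_smul, conjTranspose_one, Complex.star_def,
        Complex.conj_ofReal])
  have hV := eq_fromBlocks_of_mulVec_graph_eq_zero hM
    ((Complex.I * (Nnu ν : ℝ)) • sigmaHat x) fun C => by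
      rw [smul_mulVec]
      exact hker x hx C
  refine ⟨hM.submatrix Sum.inr, ?_⟩
  beta_reduce
  generalize (V x + ((ν / ‖x‖ : ℝ) : ℂ) • 1).toBlocks₂₂ = W at hV ⊢
  rw [eq_sub_of_add_eq hV, sub_eq_neg_add, ← neg_smul]
  simp only [conjTranspose_smul, (sigmaHat_isHermitian x).eq, smul_mul_assoc, mul_smul_comm,
    smul_smul, ← neg_smul, star_mul', Complex.star_def, Complex.conj_I, Complex.conj_ofReal]
  congr 2
  · congr 1
    linear_combination (-(Nnu ν : ℂ) ^ 2) * Complex.I_sq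
  · ring_nf
  · ring_nf
end
end
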